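/- arXiv:1502.06939 — 8 statements merged into one kernel-verified Lean document; each statement's English description precedes it below -/
import Mathlib

section
/- For every nonzero vector ξ ∈ ℝ³, the convolution of the Bessel majorizing kernel h_b(η) = e^{−|η|}/|η| with itself satisfies ∫_{ℝ³} e^{−|η|}·e^{−|ξ−η|}/(|η|·|ξ−η|) dη = 2π·e^{−|ξ|}. -/
open MeasureTheory Real
open scoped ENNReal
open Set

/-- Integration of a radial function on the plane. -/
lemma lintegral_radial_plane {h : ℝ → ℝ≥0∞} (hh : Measurable h) :
    ∫⁻ q : ℝ × ℝ, h (√(q.1 ^ 2 + q.2 ^ 2))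
      = ∫⁻ ρ in Ioi (0 : ℝ), ENNReal.ofReal (2 * π * ρ) * h ρ := by
  rw [← lintegral_comp_polarCoord_symm, polarCoord_target, Measure.volume_eq_prod,
    setLIntegral_prod]
  · refine setLIntegral_congr_fun measurableSet_Ioi fun r hr => ?_
    have hr : 0 < r := hr
    have key : ∀ θ : ℝ, √((r * cos θ) ^ 2 + (r * sin θ) ^ 2) = r := fun θ => by
      rw [show (r * cos θ) ^ 2 + (r * sin θ) ^ 2 = r ^ 2 by
        linear_combination r ^ 2 * sin_sq_add_cos_sq θ, sqrt_sq hr.le]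
    simp only [polarCoord_symm_apply, key, smul_eq_mul, setLIntegral_const, Real.volume_Ioo]
    rw [mul_right_comm, ← ENNReal.ofReal_mul hr.le]
    congr 2
    ring
  · simp only [polarCoord_symm_apply, smul_eq_mul]
    fun_prop

/-- Polar coordinates on the upper half plane. -/
lemma lintegral_half_plane_polar {g : ℝ × ℝ → ℝ≥0∞} (hg : Measurable g) :
    ∫⁻ z : ℝ, ∫⁻ ρ in Ioi (0 : ℝ), g (z, ρ)
      = ∫⁻ r in Ioi (0 : ℝ), ∫⁻ θ in Ioo 0 π,
          ENNReal.ofReal r * g (r * cos θ, r * sin θ) := by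
  have hS : MeasurableSet (univ ×ˢ Ioi 0 : Set (ℝ × ℝ)) := by measurability
  have h1 : ∫⁻ z : ℝ, ∫⁻ ρ in Ioi (0 : ℝ), g (z, ρ)
      = ∫⁻ p : ℝ × ℝ, (univ ×ˢ Ioi 0 : Set (ℝ × ℝ)).indicator g p := by
    rw [lintegral_indicator hS, Measure.volume_eq_prod, setLIntegral_prod _ hg.aemeasurable,
      Measure.restrict_univ]
  rw [h1, ← lintegral_comp_polarCoord_symm, polarCoord_target, Measure.volume_eq_prod,
    setLIntegral_prod]
  · refine setLIntegral_congr_fun measurableSet_Ioi fun r hr => ?_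
    have hr : 0 < r := hr
    have hsub : Ioo 0 π ⊆ Ioo (-π) π := Ioo_subset_Ioo (by linarith [pi_pos]) le_rfl
    rw [← inter_eq_left.mpr hsub, ← setLIntegral_indicator measurableSet_Ioo]
    refine setLIntegral_congr_fun measurableSet_Ioo fun θ hθ => ?_
    simp only [polarCoord_symm_apply, smul_eq_mul]
    by_cases h0 : 0 < θ
    · have hs := sin_pos_of_pos_of_lt_pi h0 hθ.2
      rw [indicator_of_mem (by simp [hr, hs]), indicator_of_mem (by simp [h0, hθ.2])]
    · have hs := sin_nonpos_of_nonpos_of_neg_pi_le (not_lt.mp h0) hθ.1.le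
      rw [indicator_of_notMem (by simpa using mul_nonpos_of_nonneg_of_nonpos hr.le hs),
        indicator_of_notMem (by simp [h0]), mul_zero]
  · simp only [polarCoord_symm_apply, smul_eq_mul]
    have := hg.indicator hS
    fun_prop

/-- Cylindrical coordinates for a function that is invariant under rotations
around the first axis. -/
lemma lintegral_fin_three_cylindrical {g : ℝ × ℝ → ℝ≥0∞} (hg : Measurable g) :
    ∫⁻ x : EuclideanSpace ℝ (Fin 3), g (x 0, √(x 1 ^ 2 + x 2 ^ 2))
      = ∫⁻ z : ℝ, ∫⁻ ρ in Ioi (0 : ℝ), ENNReal.ofReal (2 * π * ρ) * g (z, ρ) := by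
  have e1 := (PiLp.volume_preserving_ofLp (Fin 3)).lintegral_comp
    (f := fun x : Fin 3 → ℝ => g (x 0, √(x 1 ^ 2 + x 2 ^ 2))) (by fun_prop)
  have e2 := (volume_preserving_piFinSuccAbove (fun _ : Fin 3 => ℝ) 0).lintegral_comp
    (f := fun p : ℝ × (Fin 2 → ℝ) => g (p.1, √(p.2 0 ^ 2 + p.2 1 ^ 2))) (by fun_prop)
  refine e1.trans (e2.trans ?_)
  rw [Measure.volume_eq_prod, lintegral_prod _ (by fun_prop)]
  refine lintegral_congr fun z => ?_
  rw [← lintegral_radial_plane (h := fun ρ => g (z, ρ)) (by fun_prop)]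
  exact (volume_preserving_finTwoArrow ℝ).lintegral_comp
    (f := fun q : ℝ × ℝ => g (z, √(q.1 ^ 2 + q.2 ^ 2))) (by fun_prop)

/-- Spherical coordinates around the origin, with `ξ` as polar axis, for a function of the distances
to the origin and to `ξ`. -/
lemma lintegral_norm_norm_sub {f : ℝ × ℝ → ℝ≥0∞} (hf : Measurable f)
    {ξ : EuclideanSpace ℝ (Fin 3)} (hξ : ξ ≠ 0) :
    ∫⁻ η : EuclideanSpace ℝ (Fin 3), f (‖η‖, ‖ξ - η‖)
      = ∫⁻ r in Ioi (0 : ℝ), ∫⁻ θ in Ioo 0 π, ENNReal.ofReal (2 * π * r ^ 2 * sin θ) *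
          f (r, √(r ^ 2 - 2 * r * ‖ξ‖ * cos θ + ‖ξ‖ ^ 2)) := by
  have hR : 0 < ‖ξ‖ := norm_pos_iff.mpr hξ
  obtain ⟨b, hb⟩ := Orthonormal.exists_orthonormalBasis_extension_of_card_eq (𝕜 := ℝ)
    (E := EuclideanSpace ℝ (Fin 3)) (ι := Fin 3) (by simp)
    (v := fun _ => (‖ξ‖⁻¹ : ℝ) • ξ) (s := {0}) (by
      refine ⟨fun i => ?_, fun i j hij => (hij (Subsingleton.elim i j)).elim⟩
      simp [domRestrict, norm_smul, hR.ne'])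
  have hb0 : ξ = ‖ξ‖ • b 0 := by
    rw [hb 0 rfl, smul_smul, mul_inv_cancel₀ hR.ne', one_smul]
  have hrepr : b.repr ξ = ‖ξ‖ • EuclideanSpace.single 0 1 := by
    conv_lhs => rw [hb0]
    rw [map_smul, b.repr_self]
  set R := ‖ξ‖
  let g : ℝ × ℝ → ℝ≥0∞ := fun p =>
    f (√(p.1 ^ 2 + p.2 ^ 2), √((R - p.1) ^ 2 + p.2 ^ 2))
  have hg : Measurable g := by fun_prop
  have h1 : ∀ η, f (‖η‖, ‖ξ - η‖)
      = (fun x : EuclideanSpace ℝ (Fin 3) => g (x 0, √(x 1 ^ 2 + x 2 ^ 2))) (b.repr η) := by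
    intro η
    have n1 : ‖η‖ = ‖b.repr η‖ := (b.repr.norm_map η).symm
    have n2 : ‖ξ - η‖ = ‖R • EuclideanSpace.single 0 1 - b.repr η‖ := by
      rw [← hrepr, ← map_sub, b.repr.norm_map]
    rw [n1, n2]
    generalize b.repr η = x
    have s : √(x 1 ^ 2 + x 2 ^ 2) ^ 2 = x 1 ^ 2 + x 2 ^ 2 := sq_sqrt (by positivity)
    simp only [g, s, EuclideanSpace.norm_eq, Fin.sum_univ_three]
    simp [add_assoc]
  rw [lintegral_congr h1]
  refine (b.measurePreserving_repr.lintegral_comp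
    (f := fun x => g (x 0, √(x 1 ^ 2 + x 2 ^ 2))) (by fun_prop)).trans ?_
  rw [lintegral_fin_three_cylindrical hg, lintegral_half_plane_polar
      (g := fun p => ENNReal.ofReal (2 * π * p.2) * g p) (by fun_prop)]
  refine setLIntegral_congr_fun measurableSet_Ioi fun r hr => ?_
  have hr : 0 < r := hr
  refine setLIntegral_congr_fun measurableSet_Ioo fun θ hθ => ?_
  simp only [g]
  rw [← mul_assoc, ← ENNReal.ofReal_mul hr.le]
  have t := sin_sq_add_cos_sq θ
  rw [show (r * cos θ) ^ 2 + (r * sin θ) ^ 2 = r ^ 2 by linear_combination r ^ 2 * t,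
    show (R - r * cos θ) ^ 2 + (r * sin θ) ^ 2 = r ^ 2 - 2 * r * R * cos θ + R ^ 2 by
      linear_combination r ^ 2 * t, sqrt_sq hr.le,
    show r * (2 * π * (r * sin θ)) = 2 * π * r ^ 2 * sin θ by ring]

/-- The integral of `e^{-|ξ-η|}/|ξ-η|` over a sphere, in terms of the polar angle. -/
lemma lintegral_sin_mul_yukawa {r R : ℝ} (hr : 0 < r) (hR : 0 < R) :
    ∫⁻ θ in Ioo 0 π, ENNReal.ofReal (r * R * sin θ *
        (exp (-√(r ^ 2 - 2 * r * R * cos θ + R ^ 2)) / √(r ^ 2 - 2 * r * R * cos θ + R ^ 2)))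
      = ENNReal.ofReal (exp (-|r - R|) - exp (-(r + R))) := by
  set G : ℝ → ℝ := fun θ => -exp (-√(r ^ 2 - 2 * r * R * cos θ + R ^ 2)) with hG
  set G' : ℝ → ℝ := fun θ => r * R * sin θ *
    (exp (-√(r ^ 2 - 2 * r * R * cos θ + R ^ 2)) / √(r ^ 2 - 2 * r * R * cos θ + R ^ 2)) with hG'
  have hc : ContinuousOn G (Icc 0 π) := by fun_prop
  have hpos : ∀ θ ∈ Ioo 0 π, 0 < r ^ 2 - 2 * r * R * cos θ + R ^ 2 := by
    intro θ hθ
    have hs := sin_pos_of_pos_of_lt_pi hθ.1 hθ.2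
    have : r ^ 2 - 2 * r * R * cos θ + R ^ 2 = (R - r * cos θ) ^ 2 + (r * sin θ) ^ 2 := by
      linear_combination -r ^ 2 * sin_sq_add_cos_sq θ
    rw [this]
    positivity
  have hd : ∀ θ ∈ Ioo 0 π, HasDerivAt G (G' θ) θ := by
    intro θ hθ
    have hp := hpos θ hθ
    have h1 : HasDerivAt (fun θ => r ^ 2 - 2 * r * R * cos θ + R ^ 2) (2 * r * R * sin θ) θ := by
      refine ((((hasDerivAt_cos θ).const_mul (2 * r * R)).const_sub (r ^ 2)).add_const
        (R ^ 2)).congr_deriv ?_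
      ring
    refine ((h1.sqrt hp.ne').neg.exp).neg.congr_deriv ?_
    have := sqrt_pos.mpr hp
    simp only [hG', Pi.neg_apply]
    field_simp
  have hn : ∀ θ ∈ Ioo 0 π, 0 ≤ G' θ := fun θ hθ => by
    have hs := sin_pos_of_pos_of_lt_pi hθ.1 hθ.2
    positivity
  have hi := intervalIntegral.integrableOn_deriv_of_nonneg hc hd hn
  have hint := intervalIntegral.integral_eq_sub_of_hasDerivAt_of_le pi_pos.le hc hd
    ((intervalIntegrable_iff_integrableOn_Ioc_of_le pi_pos.le).mpr hi)
  rw [intervalIntegral.integral_of_le pi_pos.le, integral_Ioc_eq_integral_Ioo] at hint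
  rw [← ofReal_integral_eq_lintegral_ofReal (hi.mono_set Ioo_subset_Ioc_self)
    (ae_restrict_of_forall_mem measurableSet_Ioo hn), hint]
  congr 1
  simp only [hG, cos_pi, cos_zero]
  rw [show r ^ 2 - 2 * r * R * -1 + R ^ 2 = (r + R) ^ 2 by ring,
    show r ^ 2 - 2 * r * R * 1 + R ^ 2 = (r - R) ^ 2 by ring, sqrt_sq_eq_abs, sqrt_sq_eq_abs,
    abs_of_pos (add_pos hr hR)]
  ring

lemma lintegral_radial_profile {R : ℝ} (hR : 0 < R) :
    ∫⁻ r in Ioi (0 : ℝ), ENNReal.ofReal (exp (-r) * (exp (-|r - R|) - exp (-(r + R))))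
      = ENNReal.ofReal (R * exp (-R)) := by
  have hd1 : ∀ r : ℝ, HasDerivAt (fun r => -(exp (-2 * r) / 2)) (exp (-2 * r)) r := by
    intro r
    refine ((((hasDerivAt_id r).const_mul (-2 : ℝ)).exp).div_const 2).neg.congr_deriv ?_
    simp only [id, mul_one]
    ring
  have hn : ∀ r : ℝ, 0 < r → 0 ≤ exp (-r) * (exp (-|r - R|) - exp (-(r + R))) := by
    intro r hr
    refine mul_nonneg (exp_pos _).le (sub_nonneg.mpr (exp_le_exp.mpr (neg_le_neg ?_)))
    exact abs_le.mpr ⟨by linarith, by linarith⟩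
  have hcont : Continuous fun r => exp (-r) * (exp (-|r - R|) - exp (-(r + R))) := by fun_prop
  have e1 : ∀ r ∈ Icc 0 R, exp (-r) * (exp (-|r - R|) - exp (-(r + R)))
      = exp (-R) * (1 - exp (-2 * r)) := by
    intro r hr
    rw [abs_of_nonpos (by linarith [hr.2]), mul_sub, mul_sub, ← exp_add, ← exp_add, mul_one,
      ← exp_add]
    ring_nf
  have e2 : ∀ r ∈ Ioi R, exp (-r) * (exp (-|r - R|) - exp (-(r + R)))
      = (exp R - exp (-R)) * exp (-2 * r) := by
    intro r hr
    have hr : R < r := hr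
    rw [abs_of_pos (by linarith), mul_sub, sub_mul, ← exp_add, ← exp_add, ← exp_add, ← exp_add]
    ring_nf
  have i1 : ∫ r in Ioc 0 R, exp (-r) * (exp (-|r - R|) - exp (-(r + R)))
      = exp (-R) * (R + exp (-2 * R) / 2 - 1 / 2) := by
    rw [← intervalIntegral.integral_of_le hR.le, intervalIntegral.integral_eq_sub_of_hasDerivAt_of_le
      hR.le (f := fun r => exp (-R) * (r - -(exp (-2 * r) / 2))) (by fun_prop) _
      (hcont.intervalIntegrable _ _)]
    · simp
      ring
    · intro r hr
      rw [e1 r ⟨hr.1.le, hr.2.le⟩]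
      exact ((hasDerivAt_id r).sub (hd1 r)).const_mul _
  have hd2 : ∀ r ∈ Ioi R, HasDerivAt (fun r => (exp R - exp (-R)) * -(exp (-2 * r) / 2))
      (exp (-r) * (exp (-|r - R|) - exp (-(r + R)))) r := by
    intro r hr
    rw [e2 r hr]
    exact (hd1 r).const_mul _
  have ht : Filter.Tendsto (fun r => (exp R - exp (-R)) * -(exp (-2 * r) / 2)) Filter.atTop
      (nhds 0) := by
    have : Filter.Tendsto (fun r : ℝ => exp (-2 * r)) Filter.atTop (nhds 0) :=
      tendsto_exp_atBot.comp (Filter.tendsto_id.const_mul_atTop_of_neg (by norm_num))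
    simpa using ((this.div_const 2).neg).const_mul (exp R - exp (-R))
  have hn2 : ∀ r ∈ Ioi R, 0 ≤ exp (-r) * (exp (-|r - R|) - exp (-(r + R))) :=
    fun r hr => hn r (hR.trans hr)
  have hc2 : ContinuousWithinAt (fun r => (exp R - exp (-R)) * -(exp (-2 * r) / 2)) (Ici R) R := by
    fun_prop
  have i2 := integral_Ioi_of_hasDerivAt_of_nonneg hc2 hd2 hn2 ht
  have j2 := integrableOn_Ioi_deriv_of_nonneg hc2 hd2 hn2 ht
  have j1 : IntegrableOn (fun r => exp (-r) * (exp (-|r - R|) - exp (-(r + R)))) (Ioc 0 R) :=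
    (hcont.integrableOn_Icc).mono_set Ioc_subset_Icc_self
  have hU : Ioc 0 R ∪ Ioi R = Ioi 0 := Ioc_union_Ioi_eq_Ioi hR.le
  rw [← ofReal_integral_eq_lintegral_ofReal (hU ▸ j1.union j2)
    (ae_restrict_of_forall_mem measurableSet_Ioi hn), ← hU,
    setIntegral_union Ioc_disjoint_Ioi_same measurableSet_Ioi j1 j2, i1, i2]
  congr 1
  have : exp R * exp (-2 * R) = exp (-R) := by
    rw [← exp_add]
    ring_nf
  linear_combination this / 2

/-- The self-convolution of the Bessel majorizing kernel `h_b(η) = e^{−|η|}/|η|` on `ℝ³`: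
for every nonzero `ξ`, `∫ e^{−|η|} e^{−|ξ−η|}/(|η| |ξ−η|) dη = 2π e^{−|ξ|}`. -/
theorem bessel_kernel_self_convolution
    (ξ : EuclideanSpace ℝ (Fin 3)) (hξ : ξ ≠ 0) :
    ∫⁻ η : EuclideanSpace ℝ (Fin 3),
        ENNReal.ofReal (Real.exp (-‖η‖) * Real.exp (-‖ξ - η‖) / (‖η‖ * ‖ξ - η‖))
      = ENNReal.ofReal (2 * π * Real.exp (-‖ξ‖)) := by
  have hR : 0 < ‖ξ‖ := norm_pos_iff.mpr hξ
  rw [lintegral_norm_norm_sub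
    (f := fun p => ENNReal.ofReal (exp (-p.1) * exp (-p.2) / (p.1 * p.2))) (by fun_prop) hξ]
  set R := ‖ξ‖
  have hinner : ∀ r ∈ Ioi (0 : ℝ), ∫⁻ θ in Ioo 0 π, ENNReal.ofReal (2 * π * r ^ 2 * sin θ) *
        ENNReal.ofReal (exp (-r) * exp (-√(r ^ 2 - 2 * r * R * cos θ + R ^ 2)) /
          (r * √(r ^ 2 - 2 * r * R * cos θ + R ^ 2)))
      = ENNReal.ofReal (2 * π / R) *
          ENNReal.ofReal (exp (-r) * (exp (-|r - R|) - exp (-(r + R)))) := by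
    intro r hr
    have hr : 0 < r := hr
    rw [ENNReal.ofReal_mul (exp_pos _).le, ← lintegral_sin_mul_yukawa hr hR,
      ← lintegral_const_mul' _ _ ENNReal.ofReal_ne_top,
      ← lintegral_const_mul' _ _ ENNReal.ofReal_ne_top]
    refine setLIntegral_congr_fun measurableSet_Ioo fun θ hθ => ?_
    have hs := sin_pos_of_pos_of_lt_pi hθ.1 hθ.2
    rw [← ENNReal.ofReal_mul (by positivity), ← ENNReal.ofReal_mul (by positivity),
      ← ENNReal.ofReal_mul (by positivity)]
    congr 1
    field_simp
  rw [setLIntegral_congr_fun measurableSet_Ioi hinner,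
    lintegral_const_mul' _ _ ENNReal.ofReal_ne_top, lintegral_radial_profile hR,
    ← ENNReal.ofReal_mul (by positivity)]
  congr 1
  field_simp
end

section
/- For every measurable function g : (0,∞) → [0,∞] and every nonzero ξ ∈ ℝ³, one has (|ξ|/π³)·∫_{ℝ³} g(|η|/|ξ|)/(|η|²·|ξ−η|²) dη = ∫₀^∞ g(r)·𝒟(r) dr, where both sides are Lebesgue integrals with values in [0,∞]. In particular, if W is a random vector in ℝ³ with probability density H_d(η|ξ) = |ξ|/(π³·|η|²·|ξ−η|²), then |W|/|ξ| has probability density 𝒟 on (0,∞). -/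
open MeasureTheory Real

/-- The dilogarithmic density on `(0,∞)`:
`𝒟(r) = (2/π²) (1/r) ln((1+r)/|1−r|)`. -/
noncomputable def dilogDensity (r : ℝ) : ℝ :=
  (2 / π ^ 2) * (1 / r) * Real.log ((1 + r) / |1 - r|)

open Set in
/-- Polar coordinates for a function on the plane that only depends on `x² + y²`. -/
theorem lintegral_radial_prod (h : ℝ → ENNReal) (hh : Measurable h) :
    ∫⁻ p : ℝ × ℝ, h (p.1 ^ 2 + p.2 ^ 2) =
      ENNReal.ofReal (2 * π) * ∫⁻ ρ in Ioi (0 : ℝ), ENNReal.ofReal ρ * h (ρ ^ 2) := by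
  rw [← lintegral_comp_polarCoord_symm, polarCoord_target, Measure.volume_eq_prod,
    ← Measure.prod_restrict, lintegral_prod _ (by fun_prop)]
  rw [← lintegral_const_mul _ (by fun_prop)]
  refine lintegral_congr fun ρ => ?_
  have key : ∀ θ : ℝ, (ρ * cos θ) ^ 2 + (ρ * sin θ) ^ 2 = ρ ^ 2 := fun θ => by
    linear_combination ρ ^ 2 * sin_sq_add_cos_sq θ
  simp only [polarCoord_symm_apply, key, smul_eq_mul, lintegral_const,
    Measure.restrict_apply_univ, Real.volume_Ioo]
  rw [mul_comm]
  congr 2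
  ring

open Set in
/-- Polar coordinates on the upper half plane. -/
theorem lintegral_upperHalfPlane_polar (f : ℝ × ℝ → ENNReal) (hf : Measurable f) :
    ∫⁻ x : ℝ, ∫⁻ ρ in Ioi (0 : ℝ), f (x, ρ) =
      ∫⁻ r in Ioi (0 : ℝ), ENNReal.ofReal r *
        ∫⁻ θ in Ioo 0 π, f (r * cos θ, r * sin θ) := by
  have hind : Measurable ((univ ×ˢ Ioi (0 : ℝ)).indicator f) :=
    hf.indicator (MeasurableSet.univ.prod measurableSet_Ioi)
  calc
    _ = ∫⁻ p : ℝ × ℝ, (univ ×ˢ Ioi (0 : ℝ)).indicator f p := by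
      rw [Measure.volume_eq_prod, lintegral_prod _ hind.aemeasurable]
      refine lintegral_congr fun x => ?_
      rw [← lintegral_indicator measurableSet_Ioi]
      refine lintegral_congr fun ρ => ?_
      simp [indicator]
    _ = _ := by
      rw [← lintegral_comp_polarCoord_symm, polarCoord_target, Measure.volume_eq_prod,
        ← Measure.prod_restrict, lintegral_prod _ (by
          refine Measurable.aemeasurable ?_
          simp only [smul_eq_mul, polarCoord_symm_apply]
          exact (by fun_prop : Measurable fun p : ℝ × ℝ => ENNReal.ofReal p.1).mul
            (hind.comp (by fun_prop)))]
      refine setLIntegral_congr_fun measurableSet_Ioi fun r (hr : 0 < r) => ?_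
      simp only [polarCoord_symm_apply, smul_eq_mul]
      rw [lintegral_const_mul' _ _ ENNReal.ofReal_ne_top]
      congr 1
      rw [← lintegral_indicator measurableSet_Ioo, ← lintegral_indicator measurableSet_Ioo]
      refine lintegral_congr fun θ => ?_
      by_cases hθ : θ ∈ Ioo 0 π
      · have hs : 0 < sin θ := sin_pos_of_mem_Ioo hθ
        have hθ' : θ ∈ Ioo (-π) π := ⟨by linarith [hθ.1, hθ.2], hθ.2⟩
        simp [hθ, hθ', mul_pos hr hs]
      · by_cases hθ' : θ ∈ Ioo (-π) π
        · have h0 : θ ≤ 0 := by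
            by_contra! h
            exact hθ ⟨h, hθ'.2⟩
          have hs : sin θ ≤ 0 := sin_nonpos_of_nonpos_of_neg_pi_le h0 hθ'.1.le
          have : ¬ 0 < r * sin θ := not_lt.2 (mul_nonpos_of_nonneg_of_nonpos hr.le hs)
          simp [hθ, hθ', this]
        · simp [hθ, hθ']

/-- The volume on `ℝ³` as the product of the first coordinate with the plane of the other two. -/
theorem lintegral_euclideanSpace_fin_three (F : ℝ → ℝ → ENNReal)
    (hF : Measurable (Function.uncurry F)) :
    ∫⁻ x : EuclideanSpace ℝ (Fin 3), F (x 0) ‖x‖ =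
      ∫⁻ x : ℝ, ∫⁻ p : ℝ × ℝ, F x √(x ^ 2 + (p.1 ^ 2 + p.2 ^ 2)) := by
  have hF' : ∀ {α : Type} [MeasurableSpace α] {u v : α → ℝ}, Measurable u → Measurable v →
      Measurable fun a => F (u a) (v a) := fun hu hv => hF.comp (hu.prodMk hv)
  have hm : Measurable fun x : EuclideanSpace ℝ (Fin 3) => F (x 0) ‖x‖ :=
    hF' (by fun_prop) (by fun_prop)
  have e1 := (EuclideanSpace.volume_preserving_symm_measurableEquiv_toLp (Fin 3)).symm
  have e2 := (volume_preserving_piFinSuccAbove (fun _ : Fin 3 => ℝ) 0).symm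
  have e3 := (volume_preserving_finTwoArrow ℝ).symm
  have hm2 := (hm.comp e1.measurable).comp e2.measurable
  rw [← e1.lintegral_comp hm]
  refine (e2.lintegral_comp (hm.comp e1.measurable)).symm.trans ?_
  change ∫⁻ q, (((fun x : EuclideanSpace ℝ (Fin 3) => F (x 0) ‖x‖) ∘ _) ∘ _) q = _
  rw [Measure.volume_eq_prod, lintegral_prod _ hm2.aemeasurable]
  refine lintegral_congr fun x => ?_
  refine (e3.lintegral_comp (hm2.comp measurable_prodMk_left)).symm.trans ?_
  refine lintegral_congr fun p => ?_
  simp [EuclideanSpace.norm_eq, Fin.sum_univ_three, add_assoc, MeasurableEquiv.piFinSuccAbove,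
    MeasurableEquiv.finTwoArrow]

/-- Spherical coordinates for a function on `ℝ³` of the component along a unit vector `u` and of
the norm. -/
theorem lintegral_inner_norm_spherical (F : ℝ → ℝ → ENNReal)
    (hF : Measurable (Function.uncurry F)) {u : EuclideanSpace ℝ (Fin 3)} (hu : ‖u‖ = 1) :
    ∫⁻ η : EuclideanSpace ℝ (Fin 3), F (inner ℝ u η) ‖η‖ =
      ENNReal.ofReal (2 * π) * ∫⁻ r in Set.Ioi (0 : ℝ), ENNReal.ofReal (r ^ 2) *
        ∫⁻ θ in Set.Ioo 0 π, ENNReal.ofReal (sin θ) * F (r * cos θ) r := by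
  have hF' : ∀ {α : Type} [MeasurableSpace α] {u v : α → ℝ}, Measurable u → Measurable v →
      Measurable fun a => F (u a) (v a) := fun hu hv => hF.comp (hu.prodMk hv)
  obtain ⟨b, hb⟩ := Orthonormal.exists_orthonormalBasis_extension_of_card_eq (𝕜 := ℝ)
    (E := EuclideanSpace ℝ (Fin 3)) (ι := Fin 3) (by simp) (v := fun _ => u) (s := {0})
    ⟨fun _ => hu, fun i j hij => (hij (Subsingleton.elim i j)).elim⟩
  have hb0 : b 0 = u := hb 0 rfl
  calc
    _ = ∫⁻ x : EuclideanSpace ℝ (Fin 3), F (x 0) ‖x‖ := by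
      rw [← b.measurePreserving_repr.lintegral_comp
        (f := fun x => F (x 0) ‖x‖) (hF' (by fun_prop) (by fun_prop))]
      refine lintegral_congr fun η => ?_
      rw [b.repr_apply_apply, hb0, LinearIsometryEquiv.norm_map]
    _ = ENNReal.ofReal (2 * π) * ∫⁻ x : ℝ, ∫⁻ ρ in Set.Ioi (0 : ℝ),
          ENNReal.ofReal ρ * F x √(x ^ 2 + ρ ^ 2) := by
      rw [lintegral_euclideanSpace_fin_three F hF,
        ← lintegral_const_mul' _ _ ENNReal.ofReal_ne_top]
      refine lintegral_congr fun x => ?_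
      exact lintegral_radial_prod (fun t => F x √(x ^ 2 + t)) (hF' (by fun_prop) (by fun_prop))
    _ = _ := by
      rw [lintegral_upperHalfPlane_polar
        (fun p => ENNReal.ofReal p.2 * F p.1 √(p.1 ^ 2 + p.2 ^ 2))
        ((by fun_prop : Measurable fun p : ℝ × ℝ => ENNReal.ofReal p.2).mul
          (hF' (by fun_prop) (by fun_prop)))]
      congr 1
      refine setLIntegral_congr_fun measurableSet_Ioi fun r (hr : 0 < r) => ?_
      dsimp only
      rw [sq r, ENNReal.ofReal_mul hr.le, mul_assoc]
      congr 1
      rw [← lintegral_const_mul' _ _ ENNReal.ofReal_ne_top]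
      refine lintegral_congr fun θ => ?_
      have : (r * cos θ) ^ 2 + (r * sin θ) ^ 2 = r ^ 2 := by
        linear_combination r ^ 2 * sin_sq_add_cos_sq θ
      rw [this, sqrt_sq hr.le, ENNReal.ofReal_mul hr.le, mul_assoc]

/-- The spherical average of the inverse square distance to a point off the sphere. -/
theorem lintegral_sin_div_dist_sq {s r : ℝ} (hs : 0 < s) (hr : 0 < r) (hne : r ≠ s) :
    ∫⁻ θ in Set.Ioo 0 π, ENNReal.ofReal (sin θ) *
        ENNReal.ofReal (1 / (s ^ 2 + r ^ 2 - 2 * s * (r * cos θ))) =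
      ENNReal.ofReal (1 / (s * r) * log ((s + r) / |s - r|)) := by
  have hsr : 0 < (s - r) ^ 2 := by
    have := sub_ne_zero.2 hne.symm
    positivity
  have hD : ∀ θ : ℝ, 0 < s ^ 2 + r ^ 2 - 2 * s * (r * cos θ) := fun θ => by
    nlinarith [mul_nonneg (mul_pos hs hr).le (sub_nonneg.2 (cos_le_one θ))]
  have hcont : Continuous fun θ : ℝ => sin θ * (1 / (s ^ 2 + r ^ 2 - 2 * s * (r * cos θ))) :=
    continuous_sin.mul (continuous_const.div (by fun_prop) fun θ => (hD θ).ne')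
  have hderiv : ∀ θ : ℝ, HasDerivAt
      (fun θ => 1 / (2 * (s * r)) * log (s ^ 2 + r ^ 2 - 2 * s * (r * cos θ)))
      (sin θ * (1 / (s ^ 2 + r ^ 2 - 2 * s * (r * cos θ)))) θ := fun θ => by
    have h1 : HasDerivAt (fun θ => s ^ 2 + r ^ 2 - 2 * s * (r * cos θ))
        (-(2 * s * (r * -sin θ))) θ :=
      (((hasDerivAt_cos θ).const_mul r).const_mul (2 * s)).const_sub _
    refine ((h1.log (hD θ).ne').const_mul (1 / (2 * (s * r)))).congr_deriv ?_
    have := (hD θ).ne'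
    field_simp
  have hint : ∫ θ in (0 : ℝ)..π, sin θ * (1 / (s ^ 2 + r ^ 2 - 2 * s * (r * cos θ))) =
      1 / (s * r) * log ((s + r) / |s - r|) := by
    rw [intervalIntegral.integral_eq_sub_of_hasDerivAt (fun θ _ => hderiv θ)
      (hcont.intervalIntegrable _ _)]
    have e1 : s ^ 2 + r ^ 2 - 2 * s * (r * cos π) = (s + r) ^ 2 := by rw [cos_pi]; ring
    have e2 : s ^ 2 + r ^ 2 - 2 * s * (r * cos 0) = |s - r| ^ 2 := by
      rw [cos_zero, sq_abs]; ring
    rw [e1, e2, log_pow, log_pow, log_div (by positivity)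
      (abs_ne_zero.2 (sub_ne_zero.2 hne.symm))]
    push_cast
    field_simp
  rw [← hint, intervalIntegral.integral_of_le pi_pos.le, integral_Ioc_eq_integral_Ioo,
    ofReal_integral_eq_lintegral_ofReal]
  · refine setLIntegral_congr_fun measurableSet_Ioo fun θ hθ => ?_
    exact (ENNReal.ofReal_mul (sin_pos_of_mem_Ioo hθ).le).symm
  · exact (hcont.integrableOn_Icc (a := 0) (b := π)).mono_set Set.Ioo_subset_Icc_self
  · refine (ae_restrict_mem measurableSet_Ioo).mono fun θ hθ => ?_
    have := hD θ
    have := sin_pos_of_mem_Ioo hθ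
    simp only [Pi.zero_apply]
    positivity

/-- Scaling of the half-line. -/
theorem lintegral_Ioi_comp_mul_left {s : ℝ} (hs : 0 < s) (f : ℝ → ENNReal) :
    ∫⁻ r in Set.Ioi (0 : ℝ), f r =
      ENNReal.ofReal s * ∫⁻ t in Set.Ioi (0 : ℝ), f (s * t) := by
  have himage : (fun t => s * t) '' Set.Ioi (0 : ℝ) = Set.Ioi 0 := by
    rw [Set.image_mul_left_Ioi hs, mul_zero]
  have h := lintegral_image_eq_lintegral_abs_deriv_mul (f := fun t => s * t) (f' := fun _ => s)
    (s := Set.Ioi 0) measurableSet_Ioi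
    (fun x _ => by simpa using ((hasDerivAt_id x).const_mul s).hasDerivWithinAt)
    (mul_right_injective₀ hs.ne').injOn f
  rw [himage] at h
  rw [h, abs_of_pos hs, lintegral_const_mul' _ _ (by simp)]

/-- If `W` has density `H_d(η|ξ) = |ξ|/(π³ |η|² |ξ−η|²)`, then `|W|/|ξ|` has the
dilogarithmic density `𝒟` on `(0,∞)`: for every measurable `g : (0,∞) → [0,∞]` and
every nonzero `ξ ∈ ℝ³`,
`(|ξ|/π³) ∫_{ℝ³} g(|η|/|ξ|)/(|η|² |ξ−η|²) dη = ∫₀^∞ g(r) 𝒟(r) dr`. -/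
theorem dilog_radial_density
    (g : ℝ → ENNReal) (hg : Measurable g)
    (ξ : EuclideanSpace ℝ (Fin 3)) (hξ : ξ ≠ 0) :
    ENNReal.ofReal (‖ξ‖ / π ^ 3) *
        ∫⁻ η : EuclideanSpace ℝ (Fin 3),
          g (‖η‖ / ‖ξ‖) * ENNReal.ofReal (1 / (‖η‖ ^ 2 * ‖ξ - η‖ ^ 2))
      = ∫⁻ r in Set.Ioi (0 : ℝ), g r * ENNReal.ofReal (dilogDensity r) := by
  set s := ‖ξ‖
  have hs : 0 < s := norm_pos_iff.2 hξ
  let F : ℝ → ℝ → ENNReal := fun x t =>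
    g (t / s) * ENNReal.ofReal (1 / (t ^ 2 * (s ^ 2 + t ^ 2 - 2 * s * x)))
  have hF : Measurable (Function.uncurry F) := by
    unfold F Function.uncurry
    fun_prop
  have hu : ‖s⁻¹ • ξ‖ = 1 := by
    rw [norm_smul, norm_inv, norm_norm, inv_mul_cancel₀ hs.ne']
  have hη : ∀ η : EuclideanSpace ℝ (Fin 3),
      g (‖η‖ / s) * ENNReal.ofReal (1 / (‖η‖ ^ 2 * ‖ξ - η‖ ^ 2)) =
        F (inner ℝ (s⁻¹ • ξ) η) ‖η‖ := fun η => by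
    have : ‖ξ - η‖ ^ 2 = s ^ 2 + ‖η‖ ^ 2 - 2 * s * inner ℝ (s⁻¹ • ξ) η := by
      rw [norm_sub_sq_real, real_inner_smul_left]
      field_simp
      ring
    simp only [F, this]
  simp_rw [hη]
  rw [lintegral_inner_norm_spherical F hF hu, lintegral_Ioi_comp_mul_left hs, ← mul_assoc,
    ← mul_assoc, ← lintegral_const_mul' _ _ (by finiteness)]
  have hae : ∀ᵐ t : ℝ ∂volume.restrict (Set.Ioi 0), t ≠ 1 :=
    ae_restrict_of_ae (by simp [ae_iff])
  refine lintegral_congr_ae ?_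
  filter_upwards [hae, ae_restrict_mem measurableSet_Ioi] with t ht1 (ht : 0 < t)
  have hst : 0 < s * t := mul_pos hs ht
  have hne : s * t ≠ s := fun h => ht1 (by simpa [hs.ne'] using h)
  have hinner : ∫⁻ θ in Set.Ioo 0 π, ENNReal.ofReal (sin θ) * F (s * t * cos θ) (s * t) =
      g t * ENNReal.ofReal (1 / (s * t) ^ 2) *
        ENNReal.ofReal (1 / (s * (s * t)) * log ((s + s * t) / |s - s * t|)) := by
    rw [← lintegral_sin_div_dist_sq hs hst hne, ← lintegral_const_mul _ (by fun_prop)]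
    refine lintegral_congr fun θ => ?_
    simp only [F]
    rw [mul_div_cancel_left₀ _ hs.ne', ← one_div_mul_one_div, ENNReal.ofReal_mul (by positivity)]
    ring
  have hlog : (s + s * t) / |s - s * t| = (1 + t) / |1 - t| := by
    rw [← mul_one_add, ← mul_one_sub, abs_mul, abs_of_pos hs, mul_div_mul_left _ _ hs.ne']
  have hreal : s / π ^ 3 * (2 * π) * s * (s * t) ^ 2 * (1 / (s * t) ^ 2) *
      (1 / (s * (s * t)) * log ((1 + t) / |1 - t|)) = dilogDensity t := by
    unfold dilogDensity
    field_simp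
  calc
    _ = g t * (ENNReal.ofReal (s / π ^ 3) * ENNReal.ofReal (2 * π) * ENNReal.ofReal s *
          ENNReal.ofReal ((s * t) ^ 2) * ENNReal.ofReal (1 / (s * t) ^ 2) *
          ENNReal.ofReal (1 / (s * (s * t)) * log ((1 + t) / |1 - t|))) := by
      rw [hinner, hlog]
      ring
    _ = g t * ENNReal.ofReal (dilogDensity t) := by
      rw [← ENNReal.ofReal_mul (by positivity), ← ENNReal.ofReal_mul (by positivity),
        ← ENNReal.ofReal_mul (by positivity), ← ENNReal.ofReal_mul (by positivity),
        ← ENNReal.ofReal_mul (by positivity), hreal]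
end

section
/- For every integer m ≥ 1, the integral ∫₀^∞ |ln r|^m·𝒟(r) dr is finite; moreover the function r ↦ (ln r)·𝒟(r) is Lebesgue-integrable on (0,∞) with ∫₀^∞ (ln r)·𝒟(r) dr = 0. That is, all absolute moments of the logarithm of a dilogarithmic random variable are finite and its mean is zero. -/
open MeasureTheory Real

/-- The function `t ↦ ln((1+eᵗ)/|1−eᵗ|)`, which is `ln coth(|t|/2)`. -/
noncomputable def logCothHalf (t : ℝ) : ℝ :=
  Real.log ((1 + exp t) / |1 - exp t|)

lemma logCothHalf_neg (t : ℝ) : logCothHalf (-t) = logCothHalf t := by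
  unfold logCothHalf
  have hE := exp_pos t
  have h : 1 - (exp t)⁻¹ = -((1 - exp t) / exp t) := by field_simp; ring
  rw [exp_neg, h, abs_neg, abs_div, abs_of_pos hE]
  congr 1
  field_simp
  ring

lemma measurable_logCothHalf : Measurable logCothHalf := by
  unfold logCothHalf
  fun_prop

lemma exp_mul_dilogDensity_exp (t : ℝ) :
    exp t * dilogDensity (exp t) = 2 / π ^ 2 * logCothHalf t := by
  unfold dilogDensity logCothHalf
  have hE := (exp_pos t).ne'
  field_simp

lemma sq_le_two_mul_cosh_sub_one (x : ℝ) : x ^ 2 ≤ 2 * (cosh x - 1) := by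
  have h : |x / 2| ≤ |sinh (x / 2)| := by
    rw [abs_sinh]
    exact self_le_sinh_iff.2 (abs_nonneg _)
  have h2 := sq_le_sq.2 h
  have h3 : cosh x = cosh (x / 2) ^ 2 + sinh (x / 2) ^ 2 := by
    rw [← cosh_two_mul]; ring_nf
  rw [cosh_sq] at h3
  linarith

lemma sq_logCothHalf_le {t : ℝ} (ht : 0 < t) : logCothHalf t ^ 2 ≤ 2 * (t⁻¹ * exp (-t)) := by
  have hE : 1 < exp t := one_lt_exp_iff.2 ht
  have hE' : 0 < exp t - 1 := by linarith
  have hs : t ≤ sinh t := self_le_sinh_iff.2 ht.le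
  have hk : 2 * t * exp t ≤ exp t ^ 2 - 1 := by
    rw [sinh_eq, exp_neg] at hs
    have := mul_le_mul_of_nonneg_right hs (exp_pos t).le
    field_simp at this
    linarith
  unfold logCothHalf
  rw [abs_of_neg (by linarith : 1 - exp t < 0)]
  refine (sq_le_two_mul_cosh_sub_one _).trans ?_
  rw [cosh_log (div_pos (by linarith) (by linarith))]
  have hk' : 0 < exp t ^ 2 - 1 := by nlinarith
  have e : 2 * (((1 + exp t) / -(1 - exp t) + ((1 + exp t) / -(1 - exp t))⁻¹) / 2 - 1)
      = 4 / (exp t ^ 2 - 1) := by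
    rw [neg_sub]
    have h1 : exp t ^ 2 - 1 = (exp t - 1) * (1 + exp t) := by ring
    have h2 : 1 + exp t ≠ 0 := by positivity
    rw [h1]
    field_simp
    ring
  rw [e, exp_neg, ← mul_inv, ← div_eq_mul_inv, div_le_div_iff₀ hk' (by positivity)]
  linarith

lemma abs_logCothHalf_le {t : ℝ} (ht : 0 < t) :
    |logCothHalf t| ≤ √2 * (t ^ (-1 / 2 : ℝ) * exp (-(1 / 2) * t)) := by
  refine abs_le_of_sq_le_sq ((sq_logCothHalf_le ht).trans_eq ?_) (by positivity)
  rw [mul_pow, mul_pow, sq_sqrt zero_le_two, ← rpow_mul_natCast ht.le, ← exp_nat_mul,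
    ← rpow_neg_one]
  congr 3 <;> push_cast <;> ring

lemma integrableOn_pow_mul_logCothHalf (m : ℕ) :
    IntegrableOn (fun t => t ^ m * logCothHalf t) (Set.Ioi 0) := by
  have hm : (-1 : ℝ) < m + (-1 / 2 : ℝ) := by
    have := m.cast_nonneg (α := ℝ)
    linarith
  refine Integrable.mono' ((integrableOn_rpow_mul_exp_neg_mul_rpow hm one_pos
    (one_half_pos (α := ℝ))).const_mul (√2))
    ((measurable_id.pow_const m).mul measurable_logCothHalf).aestronglyMeasurable ?_
  refine (ae_restrict_iff' measurableSet_Ioi).2 (.of_forall fun t ht => ?_)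
  have ht : 0 < t := ht
  rw [norm_mul, norm_pow, norm_eq_abs, norm_eq_abs, abs_of_pos ht, rpow_one, rpow_add ht,
    rpow_natCast]
  calc t ^ m * |logCothHalf t|
      ≤ t ^ m * (√2 * (t ^ (-1 / 2 : ℝ) * exp (-(1 / 2) * t))) := by
        gcongr
        exact abs_logCothHalf_le ht
    _ = _ := by ring

lemma integrable_abs_pow_mul_logCothHalf (m : ℕ) :
    Integrable (fun t => |t| ^ m * logCothHalf t) := by
  have hpos : IntegrableOn (fun t => |t| ^ m * logCothHalf t) (Set.Ioi 0) :=
    (integrableOn_pow_mul_logCothHalf m).congr_fun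
      (fun t ht => by simp only [abs_of_pos (Set.mem_Ioi.1 ht)]) measurableSet_Ioi
  have hneg : IntegrableOn (fun t => |t| ^ m * logCothHalf t) (Set.Iic 0) := by
    have hemb : MeasurableEmbedding fun x : ℝ => -x := (Homeomorph.neg ℝ).measurableEmbedding
    rw [← Measure.map_neg_eq_self (volume : Measure ℝ), hemb.integrableOn_map_iff]
    simpa [Function.comp_def, logCothHalf_neg] using
      Iff.mpr integrableOn_Ici_iff_integrableOn_Ioi hpos
  rw [← integrableOn_univ, ← Set.Iic_union_Ioi (a := (0 : ℝ))]
  exact hneg.union hpos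

lemma integrableOn_Ioi_zero_iff_comp_exp (g : ℝ → ℝ) :
    IntegrableOn g (Set.Ioi 0) ↔ Integrable (fun t => exp t * g (exp t)) := by
  rw [← range_exp, ← Set.image_univ, ← integrableOn_univ]
  simpa [abs_of_pos (exp_pos _)] using integrableOn_image_iff_integrableOn_abs_deriv_smul
    MeasurableSet.univ (fun x _ => (hasDerivAt_exp x).hasDerivWithinAt) exp_injective.injOn g

lemma integral_Ioi_zero_eq_comp_exp (g : ℝ → ℝ) :
    ∫ r in Set.Ioi 0, g r = ∫ t, exp t * g (exp t) := by
  rw [← range_exp, ← Set.image_univ]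
  simpa [abs_of_pos (exp_pos _)] using integral_image_eq_integral_abs_deriv_smul
    MeasurableSet.univ (fun x _ => (hasDerivAt_exp x).hasDerivWithinAt) exp_injective.injOn g

lemma integrableOn_abs_log_pow_mul_dilogDensity (m : ℕ) :
    IntegrableOn (fun r => |Real.log r| ^ m * dilogDensity r) (Set.Ioi 0) := by
  rw [integrableOn_Ioi_zero_iff_comp_exp]
  simp only [log_exp, mul_left_comm (exp _), exp_mul_dilogDensity_exp,
    mul_left_comm _ (2 / π ^ 2)]
  exact (integrable_abs_pow_mul_logCothHalf m).const_mul _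

lemma measurable_dilogDensity : Measurable dilogDensity := by
  unfold dilogDensity
  fun_prop

/-- All absolute moments of the logarithm of a dilogarithmic random variable are finite,
and its mean is zero: for every `m ≥ 1`, `∫₀^∞ |ln r|^m 𝒟(r) dr < ∞`; moreover
`r ↦ (ln r) 𝒟(r)` is Lebesgue-integrable on `(0,∞)` with `∫₀^∞ (ln r) 𝒟(r) dr = 0`. -/
theorem log_dilog_moments :
    (∀ m : ℕ, 1 ≤ m →
      ∫⁻ r in Set.Ioi (0 : ℝ), ENNReal.ofReal (|Real.log r| ^ m * dilogDensity r) < ⊤) ∧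
    IntegrableOn (fun r : ℝ => Real.log r * dilogDensity r) (Set.Ioi 0) ∧
    ∫ r in Set.Ioi (0 : ℝ), Real.log r * dilogDensity r = 0 := by
  refine ⟨fun m _ => (integrableOn_abs_log_pow_mul_dilogDensity m).lintegral_lt_top, ?_, ?_⟩
  · refine Integrable.mono (integrableOn_abs_log_pow_mul_dilogDensity 1)
      (measurable_log.mul measurable_dilogDensity).aestronglyMeasurable
      (.of_forall fun r => ?_)
    simp
  · rw [integral_Ioi_zero_eq_comp_exp]
    simp only [log_exp, mul_left_comm (exp _), exp_mul_dilogDensity_exp]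
    rw [← self_eq_neg, ← integral_neg]
    conv_lhs => rw [← integral_neg_eq_self]
    simp only [logCothHalf_neg, neg_mul]
end

section
/- For all real numbers a > 0 and θ > 0, one has ∫₀^∞ (a²r²/(a²r² + θ))·𝒟(r) dr = (2/π)·arctan(a/√θ). In probabilistic terms, if R has the dilogarithmic density then 𝔼[a²R²/(a²R² + θ)] = (2/π)·arctan(a/√θ). -/
open MeasureTheory Real

open Set Filter Topology

lemma log_one_add_div_abs_one_sub {r : ℝ} (hr : 0 < r) (hr1 : r ≠ 1) :
    log ((1 + r) / |1 - r|) = log (1 + r) - log (r - 1) := by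
  rw [log_div (by positivity) (abs_ne_zero.mpr (sub_ne_zero.mpr hr1.symm)), log_abs,
    ← log_neg_eq_log (1 - r), neg_sub]

lemma log_one_add_div_abs_one_sub_nonneg {r : ℝ} (hr : 0 < r) :
    0 ≤ log ((1 + r) / |1 - r|) := by
  rcases eq_or_ne r 1 with rfl | hr1
  · simp
  · apply log_nonneg
    rw [one_le_div (abs_pos.mpr (sub_ne_zero.mpr hr1.symm)), abs_le]
    constructor <;> linarith

/-- The `t`-derivative of `t² r / (1 + t² r²)`, weighted by `log ((1 + r) / |1 - r|)`. -/
noncomputable def dilogKernel (t r : ℝ) : ℝ :=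
  2 * t * r / (1 + t ^ 2 * r ^ 2) ^ 2 * log ((1 + r) / |1 - r|)

/-- A continuous primitive on `[0, ∞)` of `dilogKernel t`. -/
noncomputable def dilogPrimitive (t r : ℝ) : ℝ :=
  ((r - 1) * log (1 + r) - (r - 1) * log (r - 1)) *
    (t * (r + 1) / ((1 + t ^ 2) * (1 + t ^ 2 * r ^ 2))) + 2 * arctan (t * r) / (1 + t ^ 2)

lemma dilogKernel_nonneg {t r : ℝ} (ht : 0 < t) (hr : 0 < r) : 0 ≤ dilogKernel t r :=
  mul_nonneg (by positivity) (log_one_add_div_abs_one_sub_nonneg hr)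

lemma measurable_dilogKernel : Measurable (Function.uncurry dilogKernel) := by
  unfold Function.uncurry dilogKernel
  fun_prop

lemma hasDerivAt_dilogPrimitive {t r : ℝ} (hr : 0 < r) (hr1 : r ≠ 1) :
    HasDerivAt (dilogPrimitive t) (dilogKernel t r) r := by
  have h1 : r - 1 ≠ 0 := sub_ne_zero.mpr hr1
  have h2 : 1 + r ≠ 0 := by positivity
  have h3 : 1 + t ^ 2 * r ^ 2 ≠ 0 := by positivity
  have h4 : 1 + t ^ 2 ≠ 0 := by positivity
  have d1 : HasDerivAt (fun r : ℝ => r - 1) 1 r := (hasDerivAt_id r).sub_const 1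
  have d2 : HasDerivAt (fun r : ℝ => 1 + r) 1 r := (hasDerivAt_id r).const_add 1
  have d2' : HasDerivAt (fun r : ℝ => t * (r + 1)) (t * 1) r :=
    ((hasDerivAt_id r).add_const 1).const_mul t
  have d3 : HasDerivAt (fun r : ℝ => (1 + t ^ 2) * (1 + t ^ 2 * r ^ 2))
      ((1 + t ^ 2) * (t ^ 2 * (2 * r))) r := by
    have := (((hasDerivAt_pow 2 r).const_mul (t ^ 2)).const_add 1).const_mul (1 + t ^ 2)
    simpa using this
  have d4 : HasDerivAt (fun r : ℝ => t * r) (t * 1) r := (hasDerivAt_id r).const_mul t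
  have key := (((d1.mul (d2.log h2)).sub (d1.mul (d1.log h1))).mul
    (d2'.div d3 (mul_ne_zero h4 h3))).add ((d4.arctan.const_mul 2).div_const (1 + t ^ 2))
  refine key.congr_deriv ?_
  simp only [dilogKernel, log_one_add_div_abs_one_sub hr hr1, Pi.sub_apply, Pi.mul_apply,
    Pi.div_apply]
  have h5 : 1 + (t * r) ^ 2 ≠ 0 := by positivity
  field_simp
  ring

lemma continuousOn_dilogPrimitive (t : ℝ) : ContinuousOn (dilogPrimitive t) (Ici 0) := by
  have h : ∀ r ∈ Ici (0 : ℝ), (1 + t ^ 2) * (1 + t ^ 2 * r ^ 2) ≠ 0 := fun r _ => by positivity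
  have hlog : ContinuousOn (fun r : ℝ => log (1 + r)) (Ici 0) :=
    ContinuousOn.log (by fun_prop) fun r hr => by
      have : (0 : ℝ) ≤ r := hr
      positivity
  have hmul : Continuous (fun r : ℝ => (r - 1) * log (r - 1)) :=
    continuous_mul_log.comp (continuous_sub_right 1)
  have harc : Continuous (fun r : ℝ => 2 * arctan (t * r) / (1 + t ^ 2)) :=
    (continuous_const.mul (continuous_arctan.comp (continuous_const_mul t))).div_const _
  refine ContinuousOn.add (ContinuousOn.mul (ContinuousOn.sub ?_ hmul.continuousOn) ?_)
    harc.continuousOn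
  · exact ContinuousOn.mul (by fun_prop) hlog
  · exact ContinuousOn.div (by fun_prop) (by fun_prop) h

lemma dilogPrimitive_zero (t : ℝ) : dilogPrimitive t 0 = 0 := by
  simp [dilogPrimitive]

lemma tendsto_dilogPrimitive {t : ℝ} (ht : 0 < t) :
    Tendsto (dilogPrimitive t) atTop (𝓝 (π / (1 + t ^ 2))) := by
  have hlog : Tendsto (fun r : ℝ => log (1 + 2 / (r - 1))) atTop (𝓝 0) := by
    have h : Tendsto (fun r : ℝ => 1 + 2 / (r - 1)) atTop (𝓝 (1 + 0)) :=
      ((tendsto_atTop_add_const_right atTop (-1 : ℝ) tendsto_id).const_div_atTop 2).const_add 1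
    simpa using h.log (by norm_num)
  have hsq : Tendsto (fun r : ℝ => 1 + t ^ 2 * r ^ 2) atTop atTop :=
    tendsto_atTop_add_const_left _ _
      ((tendsto_pow_atTop two_ne_zero).const_mul_atTop (by positivity))
  have hfac : Tendsto (fun r : ℝ => 1 / t * (1 / (1 + t ^ 2) - 1 / (1 + t ^ 2 * r ^ 2))) atTop
      (𝓝 (1 / t * (1 / (1 + t ^ 2) - 0))) :=
    ((hsq.const_div_atTop 1).const_sub _).const_mul _
  have harc : Tendsto (fun r : ℝ => 2 * arctan (t * r) / (1 + t ^ 2)) atTop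
      (𝓝 (2 * (π / 2) / (1 + t ^ 2))) :=
    (((tendsto_arctan_atTop.mono_right nhdsWithin_le_nhds).comp
      (tendsto_id.const_mul_atTop ht)).const_mul 2).div_const _
  have hlim := (hlog.mul hfac).add harc
  rw [zero_mul, zero_add, mul_div_cancel₀ π two_ne_zero] at hlim
  refine hlim.congr' ?_
  filter_upwards [eventually_gt_atTop 1] with r hr
  have h1 : r - 1 ≠ 0 := by linarith
  have h2 : 1 + r ≠ 0 := by linarith
  have h3 : 1 + 2 / (r - 1) = (1 + r) / (r - 1) := by
    field_simp
    ring
  have h4 : 1 + t ^ 2 * r ^ 2 ≠ 0 := by positivity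
  simp only [dilogPrimitive, h3, log_div h2 h1]
  field_simp
  ring

lemma lintegral_dilogKernel {t : ℝ} (ht : 0 < t) :
    ∫⁻ r in Ioi (0 : ℝ), ENNReal.ofReal (dilogKernel t r) = ENNReal.ofReal (π / (1 + t ^ 2)) := by
  have hcont := continuousOn_dilogPrimitive t
  have hcont1 : ContinuousOn (dilogPrimitive t) (Icc 0 1) := hcont.mono Icc_subset_Ici_self
  have hderiv1 : ∀ r ∈ Ioo (0 : ℝ) 1, HasDerivAt (dilogPrimitive t) (dilogKernel t r) r :=
    fun r hr => hasDerivAt_dilogPrimitive hr.1 hr.2.ne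
  have hint1 : IntegrableOn (dilogKernel t) (Ioc 0 1) :=
    intervalIntegral.integrableOn_deriv_of_nonneg hcont1 hderiv1
      fun r hr => dilogKernel_nonneg ht hr.1
  have hval1 : ∫ r in Ioc (0 : ℝ) 1, dilogKernel t r
      = dilogPrimitive t 1 - dilogPrimitive t 0 := by
    rw [← intervalIntegral.integral_of_le zero_le_one]
    exact intervalIntegral.integral_eq_sub_of_hasDerivAt_of_le zero_le_one hcont1 hderiv1
      ((intervalIntegrable_iff_integrableOn_Ioc_of_le zero_le_one).mpr hint1)
  have hcont2 : ContinuousWithinAt (dilogPrimitive t) (Ici 1) 1 :=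
    (hcont 1 (mem_Ici.mpr zero_le_one)).mono (Ici_subset_Ici.mpr zero_le_one)
  have hderiv2 : ∀ r ∈ Ioi (1 : ℝ), HasDerivAt (dilogPrimitive t) (dilogKernel t r) r :=
    fun r hr => hasDerivAt_dilogPrimitive (zero_lt_one.trans hr) (ne_of_gt hr)
  have hnonneg2 : ∀ r ∈ Ioi (1 : ℝ), 0 ≤ dilogKernel t r :=
    fun r hr => dilogKernel_nonneg ht (zero_lt_one.trans hr)
  have hint2 : IntegrableOn (dilogKernel t) (Ioi 1) :=
    integrableOn_Ioi_deriv_of_nonneg hcont2 hderiv2 hnonneg2 (tendsto_dilogPrimitive ht)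
  have hval2 : ∫ r in Ioi (1 : ℝ), dilogKernel t r = π / (1 + t ^ 2) - dilogPrimitive t 1 :=
    integral_Ioi_of_hasDerivAt_of_nonneg hcont2 hderiv2 hnonneg2 (tendsto_dilogPrimitive ht)
  have hunion : Ioc (0 : ℝ) 1 ∪ Ioi 1 = Ioi 0 := Ioc_union_Ioi_eq_Ioi zero_le_one
  have hint : IntegrableOn (dilogKernel t) (Ioi 0) := hunion ▸ hint1.union hint2
  rw [← ofReal_integral_eq_lintegral_ofReal hint
    (ae_restrict_of_forall_mem measurableSet_Ioi fun r hr => dilogKernel_nonneg ht hr),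
    ← hunion, setIntegral_union (Ioc_disjoint_Ioi le_rfl) measurableSet_Ioi hint1 hint2,
    hval1, hval2, dilogPrimitive_zero]
  congr 1
  ring

lemma lintegral_dilogKernel_left {c r : ℝ} (hc : 0 < c) (hr : 0 < r) :
    ∫⁻ t in Ioc 0 c, ENNReal.ofReal (dilogKernel t r)
      = ENNReal.ofReal (c ^ 2 * r / (1 + c ^ 2 * r ^ 2) * log ((1 + r) / |1 - r|)) := by
  have hderiv : ∀ t ∈ uIcc 0 c, HasDerivAt
      (fun t : ℝ => t ^ 2 * r / (1 + t ^ 2 * r ^ 2) * log ((1 + r) / |1 - r|))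
      (dilogKernel t r) t := fun t _ => by
    have h : 1 + t ^ 2 * r ^ 2 ≠ 0 := by positivity
    refine ((((hasDerivAt_pow 2 t).mul_const r).div
      (((hasDerivAt_pow 2 t).mul_const (r ^ 2)).const_add 1) h).mul_const _).congr_deriv ?_
    simp only [dilogKernel]
    congr 2
    push_cast
    ring
  have hcont : Continuous fun t => dilogKernel t r := by
    unfold dilogKernel
    refine Continuous.mul (Continuous.div (by fun_prop) (by fun_prop) fun t => ?_)
      continuous_const
    positivity
  have hint := hcont.intervalIntegrable (μ := volume) 0 c
  rw [← ofReal_integral_eq_lintegral_ofReal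
    ((intervalIntegrable_iff_integrableOn_Ioc_of_le hc.le).mp hint)
    (ae_restrict_of_forall_mem measurableSet_Ioc fun t ht => dilogKernel_nonneg ht.1 hr),
    ← intervalIntegral.integral_of_le hc.le,
    intervalIntegral.integral_eq_sub_of_hasDerivAt hderiv hint]
  simp

lemma lintegral_pi_div_one_add_sq {c : ℝ} (hc : 0 < c) :
    ∫⁻ t in Ioc 0 c, ENNReal.ofReal (π / (1 + t ^ 2)) = ENNReal.ofReal (π * arctan c) := by
  have hcont : Continuous fun t : ℝ => π / (1 + t ^ 2) :=
    continuous_const.div (by fun_prop) fun t => by positivity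
  have hint := hcont.intervalIntegrable (μ := volume) 0 c
  rw [← ofReal_integral_eq_lintegral_ofReal
    ((intervalIntegrable_iff_integrableOn_Ioc_of_le hc.le).mp hint)
    (Eventually.of_forall fun t => by positivity),
    ← intervalIntegral.integral_of_le hc.le]
  simp [div_eq_mul_inv]

lemma integral_mul_log_one_add_div_abs_one_sub {c : ℝ} (hc : 0 < c) :
    ∫ r in Ioi (0 : ℝ), c ^ 2 * r / (1 + c ^ 2 * r ^ 2) * log ((1 + r) / |1 - r|)
      = π * arctan c := by
  have harc : 0 ≤ arctan c := arctan_nonneg.mpr hc.le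
  rw [integral_eq_lintegral_of_nonneg_ae
    (ae_restrict_of_forall_mem measurableSet_Ioi fun r (hr : 0 < r) =>
      mul_nonneg (by positivity) (log_one_add_div_abs_one_sub_nonneg hr))
    (Measurable.aestronglyMeasurable (by fun_prop)),
    ← setLIntegral_congr_fun measurableSet_Ioi
      fun r hr => lintegral_dilogKernel_left hc hr,
    lintegral_lintegral_swap
      (measurable_dilogKernel.comp measurable_swap).ennreal_ofReal.aemeasurable,
    setLIntegral_congr_fun measurableSet_Ioc fun t ht => lintegral_dilogKernel ht.1,
    lintegral_pi_div_one_add_sq hc, ENNReal.toReal_ofReal (by positivity)]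

/-- For all `a > 0` and `θ > 0`, a dilogarithmic random variable `R` satisfies
`𝔼[a²R²/(a²R² + θ)] = (2/π) arctan(a/√θ)`. -/
theorem dilog_arctan_expectation (a θ : ℝ) (ha : 0 < a) (hθ : 0 < θ) :
    ∫ r in Set.Ioi (0 : ℝ),
        (a ^ 2 * r ^ 2 / (a ^ 2 * r ^ 2 + θ)) * dilogDensity r
      = (2 / π) * Real.arctan (a / Real.sqrt θ) := by
  have hc : 0 < a / √θ := by positivity
  have hcongr : ∀ r ∈ Ioi (0 : ℝ), (a ^ 2 * r ^ 2 / (a ^ 2 * r ^ 2 + θ)) * dilogDensity r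
      = 2 / π ^ 2 * ((a / √θ) ^ 2 * r / (1 + (a / √θ) ^ 2 * r ^ 2)
        * log ((1 + r) / |1 - r|)) := fun r (hr : 0 < r) => by
    rw [dilogDensity, div_pow, sq_sqrt hθ.le]
    have h1 : a ^ 2 * r ^ 2 + θ ≠ 0 := by positivity
    have h2 : 1 + a ^ 2 / θ * r ^ 2 ≠ 0 := by positivity
    field_simp
    ring
  rw [setIntegral_congr_fun measurableSet_Ioi hcongr, integral_const_mul,
    integral_mul_log_one_add_div_abs_one_sub hc]
  field_simp
end

section
/- Let ξ ∈ ℝ³ be nonzero and let H_b(η|ξ) = (e^{|ξ|}/(2π))·e^{−|η|}·e^{−|ξ−η|}/(|η|·|ξ−η|) be the Bessel branching density. Then for every r ≥ |ξ|, ∫_{{η ∈ ℝ³ : |η| > r}} H_b(η|ξ) dη = (e^{−2r}/(2|ξ|))·(e^{2|ξ|} − 1), and for every 0 ≤ r ≤ |ξ|, ∫_{{η ∈ ℝ³ : |η| > r}} H_b(η|ξ) dη = (1/(2|ξ|))·(1 − e^{−2r}) + (|ξ| − r)/|ξ|. In particular, a random vector W with density H_b(·|ξ) has |W| distributed with density w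 ↦ (1/|ξ|)·e^{−2w}(e^{2|ξ|} − 1) for w ≥ |ξ| and w ↦ (1/|ξ|)·(1 − e^{−2w}) for 0 ≤ w ≤ |ξ|. -/
open MeasureTheory Real

/-- The Bessel branching density on `ℝ³`:
`H_b(η|ξ) = (e^{|ξ|}/(2π)) e^{−|η|} e^{−|ξ−η|}/(|η| |ξ−η|)`. -/
noncomputable def besselBranchingDensity (ξ η : EuclideanSpace ℝ (Fin 3)) : ℝ :=
  (Real.exp ‖ξ‖ / (2 * π)) * (Real.exp (-‖η‖) * Real.exp (-‖ξ - η‖) / (‖η‖ * ‖ξ - η‖))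

open Set
open scoped ENNReal

/-- Integrating a function of the norm and of one coordinate over Euclidean 3-space, split into
the axial and the transversal variables. -/
theorem lintegral_norm_inner_eq_axial {u : EuclideanSpace ℝ (Fin 3)} (hu : ‖u‖ = 1)
    {G : ℝ × ℝ → ℝ≥0∞} (hG : Measurable G) :
    ∫⁻ η, G (‖η‖, inner ℝ u η) =
      ∫⁻ x : ℝ, ∫⁻ p : ℝ × ℝ, G (√(x ^ 2 + (p.1 ^ 2 + p.2 ^ 2)), x) := by
  obtain ⟨b, hb⟩ := Orthonormal.exists_orthonormalBasis_extension_of_card_eq (𝕜 := ℝ)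
    (E := EuclideanSpace ℝ (Fin 3)) (ι := Fin 3) (by simp) (v := fun _ => u) (s := {0})
    (by
      constructor
      · intro i; simpa using hu
      · intro i j hij; exact absurd (Subsingleton.elim i j) hij)
  have hb0 : b 0 = u := hb 0 rfl
  have e1 : MeasurePreserving (b.repr) := b.repr.measurePreserving
  have e2 := PiLp.volume_preserving_ofLp (Fin 3)
  have e3 := volume_preserving_piFinSuccAbove (fun _ : Fin 3 => ℝ) 0
  have e4 := (MeasurePreserving.id (volume : Measure ℝ)).prod (volume_preserving_finTwoArrow ℝ)
  have e := e4.comp (e3.comp (e2.comp e1))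
  have key := e.lintegral_comp
    (f := fun q : ℝ × (ℝ × ℝ) => G (√(q.1 ^ 2 + (q.2.1 ^ 2 + q.2.2 ^ 2)), q.1)) (by fun_prop)
  rw [lintegral_prod _ (by fun_prop)] at key
  rw [← key]
  refine lintegral_congr fun η => ?_
  congr 2
  · rw [← b.repr.norm_map η, EuclideanSpace.norm_eq]
    simp [Fin.sum_univ_three, MeasurableEquiv.piFinSuccAbove, MeasurableEquiv.finTwoArrow,
      Fin.insertNthEquiv, Fin.tail, add_assoc]
  · rw [← hb0]
    simp [MeasurableEquiv.piFinSuccAbove, Fin.insertNthEquiv, b.repr_apply_apply]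

/-- Polar coordinates in a plane at signed distance `x` from the origin, expressed through the
distance to the origin. -/
theorem lintegral_plane_eq_lintegral_Ioi (x : ℝ) {g : ℝ → ℝ≥0∞} (hg : Measurable g) :
    ∫⁻ p : ℝ × ℝ, g (√(x ^ 2 + (p.1 ^ 2 + p.2 ^ 2))) =
      ∫⁻ ρ in Ioi |x|, ENNReal.ofReal (2 * π * ρ) * g ρ := by
  have himg : (fun R : ℝ => √(x ^ 2 + R ^ 2)) '' Ioi 0 = Ioi |x| := by
    ext ρ
    simp only [mem_image, mem_Ioi]
    constructor
    · rintro ⟨R, hR, rfl⟩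
      exact Real.lt_sqrt_of_sq_lt (by rw [sq_abs]; nlinarith)
    · intro h
      have h0 : 0 < ρ := (abs_nonneg x).trans_lt h
      have h1 : x ^ 2 < ρ ^ 2 := sq_lt_sq.2 (by rwa [abs_of_pos h0])
      refine ⟨√(ρ ^ 2 - x ^ 2), Real.sqrt_pos.2 (by linarith), ?_⟩
      rw [Real.sq_sqrt (by linarith), add_sub_cancel, Real.sqrt_sq h0.le]
  have hinj : InjOn (fun R : ℝ => √(x ^ 2 + R ^ 2)) (Ioi 0) := by
    intro R hR S hS h
    have h := (Real.sqrt_inj (by positivity) (by positivity)).1 h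
    exact (pow_left_inj₀ (le_of_lt hR) (le_of_lt hS) two_ne_zero).1 (by linarith)
  have hder : ∀ R ∈ Ioi (0 : ℝ), HasDerivWithinAt (fun R : ℝ => √(x ^ 2 + R ^ 2))
      (R / √(x ^ 2 + R ^ 2)) (Ioi 0) R := by
    intro R hR
    have hR : 0 < R := hR
    have h := (((hasDerivAt_pow 2 R).const_add (x ^ 2)).sqrt (by positivity)).hasDerivWithinAt
      (s := Ioi 0)
    refine h.congr_deriv ?_
    have : 0 < √(x ^ 2 + R ^ 2) := by positivity
    push_cast
    field_simp
  rw [← himg, lintegral_image_eq_lintegral_abs_deriv_mul measurableSet_Ioi hder hinj,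
    ← lintegral_comp_polarCoord_symm, polarCoord_target, Measure.volume_eq_prod,
    ← Measure.prod_restrict, lintegral_prod _ (by simp only [polarCoord_symm_apply]; fun_prop)]
  refine setLIntegral_congr_fun measurableSet_Ioi fun R hR => ?_
  have hR : 0 < R := hR
  have hs : ∀ θ : ℝ, (R * Real.cos θ) ^ 2 + (R * Real.sin θ) ^ 2 = R ^ 2 := fun θ => by
    linear_combination R ^ 2 * Real.sin_sq_add_cos_sq θ
  have hpos : 0 < √(x ^ 2 + R ^ 2) := by positivity
  simp only [polarCoord_symm_apply, hs, lintegral_const, Measure.restrict_apply_univ,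
    Real.volume_Ioo, smul_eq_mul]
  rw [abs_of_pos (by positivity), ← mul_assoc, ← ENNReal.ofReal_mul (by positivity), mul_right_comm,
    ← ENNReal.ofReal_mul hR.le]
  congr 2
  field_simp
  ring

/-- Integrating a function of the norm and of one coordinate over Euclidean 3-space: spheres
centred at the origin are sliced uniformly by the coordinate. -/
theorem lintegral_norm_inner {u : EuclideanSpace ℝ (Fin 3)} (hu : ‖u‖ = 1)
    {G : ℝ × ℝ → ℝ≥0∞} (hG : Measurable G) :
    ∫⁻ η, G (‖η‖, inner ℝ u η) =
      ∫⁻ ρ in Ioi (0 : ℝ), ENNReal.ofReal (2 * π * ρ) * ∫⁻ z in Ioo (-ρ) ρ, G (ρ, z) := by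
  have hset : MeasurableSet {q : ℝ × ℝ | |q.1| < q.2} :=
    measurableSet_lt (by fun_prop) (by fun_prop)
  rw [lintegral_norm_inner_eq_axial hu hG]
  calc
    _ = ∫⁻ z : ℝ, ∫⁻ ρ : ℝ, {q : ℝ × ℝ | |q.1| < q.2}.indicator
          (fun q => ENNReal.ofReal (2 * π * q.2) * G (q.2, q.1)) (z, ρ) := by
      refine lintegral_congr fun z => ?_
      rw [lintegral_plane_eq_lintegral_Ioi z (g := fun ρ => G (ρ, z)) (by fun_prop),
        ← lintegral_indicator measurableSet_Ioi]
      rfl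
    _ = ∫⁻ ρ : ℝ, ∫⁻ z : ℝ, {q : ℝ × ℝ | |q.1| < q.2}.indicator
          (fun q => ENNReal.ofReal (2 * π * q.2) * G (q.2, q.1)) (z, ρ) :=
      lintegral_lintegral_swap (Measurable.indicator (by fun_prop) hset).aemeasurable
    _ = _ := by
      rw [← lintegral_indicator measurableSet_Ioi]
      refine lintegral_congr fun ρ => ?_
      by_cases hρ : 0 < ρ
      · rw [indicator_of_mem (show ρ ∈ Ioi (0 : ℝ) from hρ),
          ← lintegral_const_mul _ (by fun_prop), ← lintegral_indicator measurableSet_Ioo]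
        refine lintegral_congr fun z => ?_
        simp only [indicator, mem_ofPred_eq, mem_Ioo, abs_lt]
      · rw [indicator_of_notMem (show ρ ∉ Ioi (0 : ℝ) from hρ)]
        simp only [indicator, mem_ofPred_eq]
        simp only [fun z : ℝ => (not_lt.2 ((not_lt.1 hρ).trans (abs_nonneg z))), if_false,
          lintegral_zero]

/-- The angular integral of the Yukawa potential with pole at distance `a` over the sphere of
radius `ρ`. -/
theorem lintegral_exp_neg_sqrt_div_sqrt {a ρ : ℝ} (ha : 0 < a) (hρ : 0 < ρ) (hne : ρ ≠ a) :
    ∫⁻ z in Ioo (-ρ) ρ, ENNReal.ofReal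
        (Real.exp (-√(ρ ^ 2 - 2 * a * z + a ^ 2)) / √(ρ ^ 2 - 2 * a * z + a ^ 2)) =
      ENNReal.ofReal ((Real.exp (-|ρ - a|) - Real.exp (-(ρ + a))) / a) := by
  have hle : -ρ ≤ ρ := by linarith
  have hpos : ∀ z ∈ Icc (-ρ) ρ, 0 < ρ ^ 2 - 2 * a * z + a ^ 2 := by
    intro z hz
    have : 0 < (ρ - a) ^ 2 := by have := sub_ne_zero.2 hne; positivity
    nlinarith [mul_le_mul_of_nonneg_left hz.2 ha.le]
  have hcont : ContinuousOn (fun z => Real.exp (-√(ρ ^ 2 - 2 * a * z + a ^ 2)) /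
      √(ρ ^ 2 - 2 * a * z + a ^ 2)) (Icc (-ρ) ρ) := by
    refine ContinuousOn.div (by fun_prop) (by fun_prop) fun z hz => ?_
    exact (Real.sqrt_pos.2 (hpos z hz)).ne'
  have hder : ∀ z ∈ uIcc (-ρ) ρ,
      HasDerivAt (fun z => Real.exp (-√(ρ ^ 2 - 2 * a * z + a ^ 2)) / a)
        (Real.exp (-√(ρ ^ 2 - 2 * a * z + a ^ 2)) / √(ρ ^ 2 - 2 * a * z + a ^ 2)) z := by
    intro z hz
    rw [uIcc_of_le hle] at hz
    have h0 := hpos z hz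
    have h1 : HasDerivAt (fun z => ρ ^ 2 - 2 * a * z + a ^ 2) (-(2 * a * 1)) z :=
      (((hasDerivAt_id z).const_mul (2 * a)).const_sub (ρ ^ 2)).add_const (a ^ 2)
    refine (h1.sqrt h0.ne').fun_neg.exp.div_const a |>.congr_deriv ?_
    have := Real.sqrt_pos.2 h0
    field_simp
  rw [setLIntegral_congr Ioo_ae_eq_Ioc, ← ofReal_integral_eq_lintegral_ofReal
    (hcont.integrableOn_Icc.mono_set Ioc_subset_Icc_self)
    (Filter.Eventually.of_forall fun z => by positivity),
    ← intervalIntegral.integral_of_le hle,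
    intervalIntegral.integral_eq_sub_of_hasDerivAt hder
      (by rw [intervalIntegrable_iff_integrableOn_Icc_of_le hle]; exact hcont.integrableOn_Icc)]
  have e1 : ρ ^ 2 - 2 * a * ρ + a ^ 2 = (ρ - a) ^ 2 := by ring
  have e2 : ρ ^ 2 - 2 * a * -ρ + a ^ 2 = (ρ + a) ^ 2 := by ring
  rw [e1, e2, Real.sqrt_sq_eq_abs, Real.sqrt_sq (by positivity), ← sub_div]

/-- The radial density of a random vector with the Bessel branching density. -/
theorem lintegral_besselBranchingDensity {ξ : EuclideanSpace ℝ (Fin 3)} (hξ : ξ ≠ 0) {r : ℝ}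
    (hr : 0 ≤ r) :
    ∫⁻ η in {η : EuclideanSpace ℝ (Fin 3) | r < ‖η‖},
        ENNReal.ofReal (besselBranchingDensity ξ η) =
      ∫⁻ ρ in Ioi r, ENNReal.ofReal (Real.exp ‖ξ‖ * Real.exp (-ρ) *
        (Real.exp (-|ρ - ‖ξ‖|) - Real.exp (-(ρ + ‖ξ‖))) / ‖ξ‖) := by
  set a := ‖ξ‖ with ha_def
  have ha : 0 < a := norm_pos_iff.2 hξ
  have hu : ‖a⁻¹ • ξ‖ = 1 := by
    rw [norm_smul, norm_inv, norm_norm]; exact inv_mul_cancel₀ ha.ne'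
  set F : ℝ × ℝ → ℝ := fun q => Real.exp a / (2 * π) * (Real.exp (-q.1) / q.1) *
    (Real.exp (-√(q.1 ^ 2 - 2 * a * q.2 + a ^ 2)) / √(q.1 ^ 2 - 2 * a * q.2 + a ^ 2)) with hF
  have hset : MeasurableSet {q : ℝ × ℝ | r < q.1} := measurableSet_lt (by fun_prop) (by fun_prop)
  have hG : Measurable ({q : ℝ × ℝ | r < q.1}.indicator fun q => ENNReal.ofReal (F q)) :=
    Measurable.indicator (by fun_prop) hset
  have hdens : ∀ η, besselBranchingDensity ξ η = F (‖η‖, inner ℝ (a⁻¹ • ξ) η) := by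
    intro η
    have h : ‖ξ - η‖ = √(‖η‖ ^ 2 - 2 * a * inner ℝ (a⁻¹ • ξ) η + a ^ 2) := by
      rw [← Real.sqrt_sq (norm_nonneg (ξ - η)), norm_sub_sq_real, real_inner_smul_left]
      congr 1
      field_simp
      ring
    rw [besselBranchingDensity, hF]
    simp only [← h, ← ha_def]
    ring
  rw [← lintegral_indicator (measurableSet_lt (by fun_prop) (by fun_prop))]
  trans ∫⁻ η : EuclideanSpace ℝ (Fin 3), {q : ℝ × ℝ | r < q.1}.indicator
    (fun q => ENNReal.ofReal (F q)) (‖η‖, inner ℝ (a⁻¹ • ξ) η)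
  · refine lintegral_congr fun η => ?_
    simp only [indicator, mem_ofPred_eq, hdens]
  rw [lintegral_norm_inner hu hG, ← lintegral_indicator measurableSet_Ioi,
    ← lintegral_indicator measurableSet_Ioi]
  refine lintegral_congr_ae ?_
  filter_upwards [Measure.ae_ne volume a] with ρ hne
  by_cases hρ : r < ρ
  · have h0 : 0 < ρ := hr.trans_lt hρ
    simp only [indicator, mem_ofPred_eq, mem_Ioi, hρ, h0, if_true, hF]
    simp_rw [fun x => ENNReal.ofReal_mul (q := x)
      (show 0 ≤ Real.exp a / (2 * π) * (Real.exp (-ρ) / ρ) by positivity)]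
    rw [lintegral_const_mul _ (by fun_prop), lintegral_exp_neg_sqrt_div_sqrt ha h0 hne,
      ← mul_assoc, ← ENNReal.ofReal_mul (by positivity), ← ENNReal.ofReal_mul (by positivity)]
    congr 1
    field_simp
  · simp [indicator, hρ]

theorem lintegral_Ioi_exp_neg_two_mul (c r : ℝ) (hc : 0 ≤ c) :
    ∫⁻ ρ in Ioi r, ENNReal.ofReal (c * Real.exp (-2 * ρ)) =
      ENNReal.ofReal (c * Real.exp (-(2 * r)) / 2) := by
  rw [← ofReal_integral_eq_lintegral_ofReal
    ((integrableOn_exp_mul_Ioi (by norm_num) r).const_mul c)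
    (Filter.Eventually.of_forall fun ρ => by positivity),
    integral_const_mul, integral_exp_mul_Ioi (by norm_num)]
  congr 1
  ring_nf

theorem lintegral_Ioc_one_sub_exp_neg_two_mul {a r : ℝ} (ha : 0 < a) (hr : 0 ≤ r) (hra : r ≤ a) :
    ∫⁻ ρ in Ioc r a, ENNReal.ofReal ((1 - Real.exp (-(2 * ρ))) / a) =
      ENNReal.ofReal ((a - r) / a - (Real.exp (-(2 * r)) - Real.exp (-(2 * a))) / (2 * a)) := by
  have hcont : Continuous fun ρ => (1 - Real.exp (-(2 * ρ))) / a := by fun_prop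
  have hder : ∀ ρ ∈ uIcc r a, HasDerivAt (fun ρ => (ρ + Real.exp (-(2 * ρ)) / 2) / a)
      ((1 - Real.exp (-(2 * ρ))) / a) ρ := by
    intro ρ _
    have h := ((hasDerivAt_id ρ).fun_add
      ((((hasDerivAt_id ρ).const_mul 2).fun_neg.exp).div_const 2)).div_const a
    refine h.congr_deriv ?_
    rw [id]
    ring
  rw [← ofReal_integral_eq_lintegral_ofReal, ← intervalIntegral.integral_of_le hra,
    intervalIntegral.integral_eq_sub_of_hasDerivAt hder (hcont.intervalIntegrable _ _)]
  · congr 1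
    field_simp
    ring
  · exact hcont.integrableOn_Ioc
  · filter_upwards [ae_restrict_mem measurableSet_Ioc] with ρ hρ
    have : Real.exp (-(2 * ρ)) ≤ 1 := Real.exp_le_one_iff.2 (by linarith [hρ.1])
    exact div_nonneg (by linarith) ha.le

theorem lintegral_Ioi_radial_of_norm_le {ξ : EuclideanSpace ℝ (Fin 3)} (hξ : ξ ≠ 0) {r : ℝ}
    (hr : ‖ξ‖ ≤ r) :
    ∫⁻ ρ in Ioi r, ENNReal.ofReal (Real.exp ‖ξ‖ * Real.exp (-ρ) *
        (Real.exp (-|ρ - ‖ξ‖|) - Real.exp (-(ρ + ‖ξ‖))) / ‖ξ‖) =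
      ENNReal.ofReal ((Real.exp (-(2 * r)) / (2 * ‖ξ‖)) * (Real.exp (2 * ‖ξ‖) - 1)) := by
  have ha : 0 < ‖ξ‖ := norm_pos_iff.2 hξ
  have hc : 0 ≤ (Real.exp (2 * ‖ξ‖) - 1) / ‖ξ‖ :=
    div_nonneg (by linarith [Real.one_le_exp (x := 2 * ‖ξ‖) (by positivity)]) ha.le
  trans ENNReal.ofReal ((Real.exp (2 * ‖ξ‖) - 1) / ‖ξ‖ * Real.exp (-(2 * r)) / 2)
  · rw [← lintegral_Ioi_exp_neg_two_mul _ _ hc]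
    refine setLIntegral_congr_fun measurableSet_Ioi fun ρ hρ => ?_
    have hρ : r < ρ := hρ
    rw [abs_of_pos (by linarith), mul_sub, ← Real.exp_add, ← Real.exp_add, ← Real.exp_add,
      div_mul_eq_mul_div, sub_mul, ← Real.exp_add]
    ring_nf
  · congr 1
    field_simp

/-- Tail distribution of the norm of a random vector `W` with the Bessel branching
density `H_b(·|ξ)`: for `r ≥ |ξ|`,
`ℙ(|W| > r) = (e^{−2r}/(2|ξ|))(e^{2|ξ|} − 1)`, and for `0 ≤ r ≤ |ξ|`,
`ℙ(|W| > r) = (1/(2|ξ|))(1 − e^{−2r}) + (|ξ| − r)/|ξ|`. -/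
theorem bessel_norm_tail_distribution
    (ξ : EuclideanSpace ℝ (Fin 3)) (hξ : ξ ≠ 0) :
    (∀ r : ℝ, ‖ξ‖ ≤ r →
      ∫⁻ η in {η : EuclideanSpace ℝ (Fin 3) | r < ‖η‖},
          ENNReal.ofReal (besselBranchingDensity ξ η)
        = ENNReal.ofReal ((Real.exp (-(2 * r)) / (2 * ‖ξ‖)) * (Real.exp (2 * ‖ξ‖) - 1))) ∧
    (∀ r : ℝ, 0 ≤ r → r ≤ ‖ξ‖ →
      ∫⁻ η in {η : EuclideanSpace ℝ (Fin 3) | r < ‖η‖},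
          ENNReal.ofReal (besselBranchingDensity ξ η)
        = ENNReal.ofReal ((1 / (2 * ‖ξ‖)) * (1 - Real.exp (-(2 * r)))
            + (‖ξ‖ - r) / ‖ξ‖)) := by
  have ha : 0 < ‖ξ‖ := norm_pos_iff.2 hξ
  refine ⟨fun r hr => ?_, fun r hr hra => ?_⟩
  · rw [lintegral_besselBranchingDensity hξ (ha.le.trans hr), lintegral_Ioi_radial_of_norm_le hξ hr]
  · rw [lintegral_besselBranchingDensity hξ hr, ← Ioc_union_Ioi_eq_Ioi hra,
      lintegral_union measurableSet_Ioi (Ioc_disjoint_Ioi le_rfl),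
      lintegral_Ioi_radial_of_norm_le hξ le_rfl]
    trans ENNReal.ofReal ((‖ξ‖ - r) / ‖ξ‖ -
        (Real.exp (-(2 * r)) - Real.exp (-(2 * ‖ξ‖))) / (2 * ‖ξ‖)) +
      ENNReal.ofReal (Real.exp (-(2 * ‖ξ‖)) / (2 * ‖ξ‖) * (Real.exp (2 * ‖ξ‖) - 1))
    · rw [← lintegral_Ioc_one_sub_exp_neg_two_mul ha hr hra]
      congr 1
      refine setLIntegral_congr_fun measurableSet_Ioc fun ρ hρ => ?_
      rw [abs_of_nonpos (by linarith [hρ.2]), mul_sub, ← Real.exp_add, ← Real.exp_add,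
        ← Real.exp_add]
      congr 3
      · rw [← Real.exp_zero]; ring_nf
      · ring_nf
    · have h1 : 1 ≤ Real.exp (2 * ‖ξ‖) := Real.one_le_exp (by positivity)
      rw [← ENNReal.ofReal_add]
      · congr 1
        have h2 : Real.exp (-(2 * ‖ξ‖)) * Real.exp (2 * ‖ξ‖) = 1 := by
          rw [← Real.exp_add, neg_add_cancel, Real.exp_zero]
        rw [mul_sub, div_mul_eq_mul_div, h2]
        field_simp
        ring
      · have h3 : Real.exp (-(2 * r)) - Real.exp (-(2 * ‖ξ‖)) ≤ 2 * (‖ξ‖ - r) := by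
          have h4 := Real.add_one_le_exp (-(2 * (‖ξ‖ - r)))
          have h5 : Real.exp (-(2 * ‖ξ‖)) =
              Real.exp (-(2 * r)) * Real.exp (-(2 * (‖ξ‖ - r))) := by
            rw [← Real.exp_add]; ring_nf
          have h6 : Real.exp (-(2 * r)) ≤ 1 := Real.exp_le_one_iff.2 (by linarith)
          rw [h5]
          nlinarith [Real.exp_pos (-(2 * r))]
        rw [sub_nonneg, div_le_div_iff₀ (by positivity) ha]
        nlinarith
      · exact mul_nonneg (by positivity) (by linarith)
end

section
/- For every nonzero ξ ∈ ℝ³, the Bessel branching density H_b(η|ξ) = (e^{|ξ|}/(2π))·e^{−|η|}·e^{−|ξ−η|}/(|η|·|ξ−η|) satisfies the mean-reversion identity ∫_{ℝ³} |η|·H_b(η|ξ) dη = (|ξ| + 1)/2; that is, a random vector W with density H_b(·|ξ) satisfies 𝔼|W| = (|ξ| + 1)/2. -/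
open MeasureTheory Real

open Set Filter Topology
open scoped ENNReal

theorem lintegral_Ioo_eq_sub_of_hasDerivAt_of_nonneg {F f : ℝ → ℝ} {a b : ℝ} (hab : a ≤ b)
    (hcont : ContinuousOn F (Icc a b)) (hderiv : ∀ x ∈ Ioo a b, HasDerivAt F (f x) x)
    (hf : ∀ x ∈ Ioo a b, 0 ≤ f x) :
    ∫⁻ x in Ioo a b, ENNReal.ofReal (f x) = ENNReal.ofReal (F b - F a) := by
  have hint : IntegrableOn f (Ioc a b) :=
    intervalIntegral.integrableOn_deriv_of_nonneg hcont hderiv hf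
  have hint' : IntegrableOn f (Ioo a b) := hint.mono_set Ioo_subset_Ioc_self
  rw [← ofReal_integral_eq_lintegral_ofReal hint'
    ((ae_restrict_iff' measurableSet_Ioo).2 (ae_of_all _ hf)), ← integral_Ioc_eq_integral_Ioo,
    ← intervalIntegral.integral_of_le hab,
    intervalIntegral.integral_eq_sub_of_hasDerivAt_of_le hab hcont hderiv
      ((intervalIntegrable_iff_integrableOn_Ioc_of_le hab).2 hint)]

theorem lintegral_Ioi_eq_sub_of_hasDerivAt_of_nonneg {F f : ℝ → ℝ} {a l : ℝ}
    (hderiv : ∀ x ∈ Ici a, HasDerivAt F (f x) x) (hf : ∀ x ∈ Ioi a, 0 ≤ f x)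
    (hF : Tendsto F atTop (𝓝 l)) :
    ∫⁻ x in Ioi a, ENNReal.ofReal (f x) = ENNReal.ofReal (l - F a) := by
  rw [← ofReal_integral_eq_lintegral_ofReal (integrableOn_Ioi_deriv_of_nonneg' hderiv hf hF)
    ((ae_restrict_iff' measurableSet_Ioi).2 (ae_of_all _ hf)),
    integral_Ioi_of_hasDerivAt_of_nonneg' hderiv hf hF]

/-- Polar coordinates for a function of the distance to the origin in the plane. -/
theorem lintegral_radial_plane_s11 {g : ℝ → ℝ≥0∞} (hg : Measurable g) :
    ∫⁻ p : ℝ × ℝ, g (p.1 ^ 2 + p.2 ^ 2)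
      = ENNReal.ofReal (2 * π) * ∫⁻ s in Ioi (0 : ℝ), ENNReal.ofReal s * g (s ^ 2) := by
  rw [← lintegral_comp_polarCoord_symm, polarCoord_target, Measure.volume_eq_prod,
    ← Measure.prod_restrict]
  have h : ∀ p : ℝ × ℝ, (polarCoord.symm p).1 ^ 2 + (polarCoord.symm p).2 ^ 2 = p.1 ^ 2 := by
    intro p
    simp only [polarCoord_symm_apply]
    linear_combination p.1 ^ 2 * Real.sin_sq_add_cos_sq p.2
  simp only [h, smul_eq_mul]
  rw [lintegral_prod _ (by fun_prop), mul_comm, ← lintegral_mul_const _ (by fun_prop)]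
  refine lintegral_congr fun s => ?_
  simp only [lintegral_const]
  simp [two_mul]

/-- The substitution `a = √(z² + s²)`. -/
theorem lintegral_sqrt_sq_add_sq (z : ℝ) (g : ℝ → ℝ≥0∞) :
    ∫⁻ s in Ioi (0 : ℝ), ENNReal.ofReal s * g (√(z ^ 2 + s ^ 2))
      = ∫⁻ a in Ioi |z|, ENNReal.ofReal a * g a := by
  have himage : (fun s : ℝ => √(z ^ 2 + s ^ 2)) '' Ioi 0 = Ioi |z| := by
    ext a
    constructor
    · rintro ⟨s, hs, rfl⟩
      rw [mem_Ioi] at hs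
      exact Real.lt_sqrt_of_sq_lt (by rw [sq_abs]; nlinarith)
    · intro ha
      rw [mem_Ioi] at ha
      have hz : z ^ 2 < a ^ 2 := by
        rw [← sq_abs z]
        exact pow_lt_pow_left₀ ha (abs_nonneg z) two_ne_zero
      refine ⟨√(a ^ 2 - z ^ 2), Real.sqrt_pos.2 (by linarith), ?_⟩
      have : √(a ^ 2 - z ^ 2) ^ 2 = a ^ 2 - z ^ 2 := Real.sq_sqrt (by linarith)
      simp only [this, add_sub_cancel, Real.sqrt_sq ((abs_nonneg z).trans ha.le)]
  have hpos : ∀ s ∈ Ioi (0 : ℝ), 0 < z ^ 2 + s ^ 2 := by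
    intro s hs
    rw [mem_Ioi] at hs
    positivity
  have hinj : InjOn (fun s : ℝ => √(z ^ 2 + s ^ 2)) (Ioi 0) := by
    intro s hs t ht hst
    have := (Real.sqrt_inj (hpos s hs).le (hpos t ht).le).1 hst
    exact (pow_left_inj₀ (le_of_lt hs) (le_of_lt ht) two_ne_zero).1 (by linarith)
  have hderiv : ∀ s ∈ Ioi (0 : ℝ), HasDerivWithinAt (fun s : ℝ => √(z ^ 2 + s ^ 2))
      (s / √(z ^ 2 + s ^ 2)) (Ioi 0) s := by
    intro s hs
    have := (((hasDerivAt_id s).pow 2).const_add (z ^ 2)).sqrt (hpos s hs).ne'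
    refine (this.congr_deriv ?_).hasDerivWithinAt
    simp [mul_div_mul_left]
  rw [← himage, lintegral_image_eq_lintegral_abs_deriv_mul measurableSet_Ioi hderiv hinj]
  refine setLIntegral_congr_fun measurableSet_Ioi fun s hs => ?_
  have h0 : 0 < √(z ^ 2 + s ^ 2) := Real.sqrt_pos.2 (hpos s hs)
  rw [mem_Ioi] at hs
  rw [← mul_assoc, ← ENNReal.ofReal_mul (abs_nonneg _), abs_of_pos (by positivity),
    div_mul_cancel₀ _ h0.ne']

/-- Integration of a function of the norm and of one coordinate over three-dimensional space. -/
theorem lintegral_norm_coord {f : ℝ → ℝ → ℝ≥0∞} (hf : Measurable (Function.uncurry f)) :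
    ∫⁻ x : EuclideanSpace ℝ (Fin 3), f ‖x‖ (x 0)
      = ENNReal.ofReal (2 * π) *
        ∫⁻ a in Ioi (0 : ℝ), ENNReal.ofReal a * ∫⁻ z in Ioo (-a) a, f a z := by
  have hf' : ∀ {α : Type} [MeasurableSpace α] {u v : α → ℝ}, Measurable u → Measurable v →
      Measurable fun x => f (u x) (v x) := fun hu hv => hf.comp (hu.prodMk hv)
  have hcart : ∫⁻ x : EuclideanSpace ℝ (Fin 3), f ‖x‖ (x 0)
      = ∫⁻ z : ℝ, ∫⁻ p : ℝ × ℝ, f (√(z ^ 2 + (p.1 ^ 2 + p.2 ^ 2))) z := by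
    have h1 := (PiLp.volume_preserving_ofLp (Fin 3)).lintegral_comp
      (f := fun y : Fin 3 → ℝ => f (√(y 0 ^ 2 + (y 1 ^ 2 + y 2 ^ 2))) (y 0))
      (hf' (by fun_prop) (by fun_prop))
    have h2 := (volume_preserving_piFinSuccAbove (fun _ : Fin 3 => ℝ) 0).lintegral_comp
      (f := fun y : ℝ × (Fin 2 → ℝ) => f (√(y.1 ^ 2 + (y.2 0 ^ 2 + y.2 1 ^ 2))) y.1)
      (hf' (by fun_prop) (by fun_prop))
    have h3 : ∀ z : ℝ, _ := fun z => (volume_preserving_finTwoArrow ℝ).lintegral_comp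
      (f := fun p : ℝ × ℝ => f (√(z ^ 2 + (p.1 ^ 2 + p.2 ^ 2))) z)
      (hf' (by fun_prop) (by fun_prop))
    rw [Measure.volume_eq_prod, lintegral_prod _ (hf' (by fun_prop) (by fun_prop)).aemeasurable]
      at h2
    simp only [← h3]
    refine Eq.trans ?_ (h1.trans (Eq.trans ?_ h2))
    · refine lintegral_congr fun x => ?_
      simp [EuclideanSpace.norm_eq, Fin.sum_univ_three, add_assoc]
    · rfl
  have hinner : ∀ z : ℝ, ∫⁻ p : ℝ × ℝ, f (√(z ^ 2 + (p.1 ^ 2 + p.2 ^ 2))) z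
      = ENNReal.ofReal (2 * π) * ∫⁻ a in Ioi |z|, ENNReal.ofReal a * f a z := by
    intro z
    rw [← lintegral_sqrt_sq_add_sq z fun a => f a z]
    exact lintegral_radial_plane_s11 (g := fun t => f (√(z ^ 2 + t)) z)
      (hf' (by fun_prop) (by fun_prop))
  simp only [hcart, hinner]
  rw [lintegral_const_mul' _ _ ENNReal.ofReal_ne_top]
  congr 1
  have hmeas : MeasurableSet {p : ℝ × ℝ | |p.1| < p.2} :=
    measurableSet_lt (by fun_prop) (by fun_prop)
  calc ∫⁻ z : ℝ, ∫⁻ a in Ioi |z|, ENNReal.ofReal a * f a z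
      = ∫⁻ z : ℝ, ∫⁻ a : ℝ, {p : ℝ × ℝ | |p.1| < p.2}.indicator
          (fun p => ENNReal.ofReal p.2 * f p.2 p.1) (z, a) := by
        refine lintegral_congr fun z => ?_
        rw [← lintegral_indicator measurableSet_Ioi]
        rfl
    _ = ∫⁻ a : ℝ, ∫⁻ z : ℝ, {p : ℝ × ℝ | |p.1| < p.2}.indicator
          (fun p => ENNReal.ofReal p.2 * f p.2 p.1) (z, a) := by
        refine lintegral_lintegral_swap (Measurable.aemeasurable ?_)
        refine Measurable.indicator ?_ hmeas
        exact (ENNReal.measurable_ofReal.comp measurable_snd).mul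
          (hf' measurable_snd measurable_fst)
    _ = ∫⁻ a in Ioi (0 : ℝ), ENNReal.ofReal a * ∫⁻ z in Ioo (-a) a, f a z := by
        rw [← lintegral_indicator measurableSet_Ioi]
        refine lintegral_congr fun a => ?_
        by_cases ha : a ∈ Ioi (0 : ℝ)
        · rw [indicator_of_mem ha, ← lintegral_const_mul' _ _ ENNReal.ofReal_ne_top,
            ← lintegral_indicator measurableSet_Ioo]
          refine lintegral_congr fun z => ?_
          simp only [indicator_apply, mem_ofPred_eq, mem_Ioo, abs_lt]
        · rw [indicator_of_notMem ha]
          refine (lintegral_congr fun z => ?_).trans lintegral_zero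
          refine indicator_of_notMem (fun h => ha ?_) _
          exact (abs_nonneg z).trans_lt h

/-- The integral of `e^{-b} / b` over the sphere of radius `a`, parametrized by one coordinate `z`,
where `b = √(r² - 2rz + a²)` is the distance to the point at distance `r` on the axis. -/
theorem lintegral_exp_neg_dist_div_dist {r a : ℝ} (hr : 0 < r) (ha : 0 < a) :
    ∫⁻ z in Ioo (-a) a, ENNReal.ofReal
        (exp (-√(r ^ 2 - 2 * r * z + a ^ 2)) / √(r ^ 2 - 2 * r * z + a ^ 2))
      = ENNReal.ofReal ((exp (-|r - a|) - exp (-(r + a))) / r) := by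
  have hpos : ∀ z ∈ Ioo (-a) a, 0 < r ^ 2 - 2 * r * z + a ^ 2 := by
    intro z hz
    nlinarith [sq_nonneg (r - a), mul_pos hr (sub_pos.2 hz.2)]
  rw [lintegral_Ioo_eq_sub_of_hasDerivAt_of_nonneg
    (F := fun z => exp (-√(r ^ 2 - 2 * r * z + a ^ 2)) / r) (by linarith) (by fun_prop) ?_
    (fun z _ => by positivity)]
  · have h1 : r ^ 2 - 2 * r * a + a ^ 2 = (r - a) ^ 2 := by ring
    have h2 : r ^ 2 - 2 * r * -a + a ^ 2 = (r + a) ^ 2 := by ring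
    simp only [h1, h2, Real.sqrt_sq_eq_abs, abs_of_pos (add_pos hr ha), sub_div]
  · intro z hz
    have h0 := Real.sqrt_pos.2 (hpos z hz)
    have hd : HasDerivAt (fun z => r ^ 2 - 2 * r * z + a ^ 2) (-(2 * r)) z := by
      simpa using (((hasDerivAt_id z).const_mul (2 * r)).const_sub (r ^ 2)).add_const (a ^ 2)
    refine (((hd.sqrt (hpos z hz).ne').neg.exp).div_const r).congr_deriv ?_
    simp only [Pi.neg_apply]
    field_simp

/-- The radial integral left after integrating over spheres. -/
theorem lintegral_radial_exp {r : ℝ} (hr : 0 < r) :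
    ∫⁻ a in Ioi (0 : ℝ), ENNReal.ofReal
        (a * (exp (-a) * ((exp (-|r - a|) - exp (-(r + a))) / r)))
      = ENNReal.ofReal (exp (-r) * (r + 1) / 2) := by
  have hexp : ∀ x : ℝ, HasDerivAt (fun x => exp (-(2 * x))) (-2 * exp (-(2 * x))) x := by
    intro x
    refine (((hasDerivAt_id x).const_mul 2).neg.exp).congr_deriv ?_
    simp
    ring
  have hsplit : Ioi (0 : ℝ) = Ioc 0 r ∪ Ioi r := (Ioc_union_Ioi_eq_Ioi hr.le).symm
  have hcont : ContinuousOn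
      (fun a => exp (-r) / r * (a ^ 2 / 2 + (a / 2 + 1 / 4) * exp (-(2 * a)))) (Icc 0 r) := by
    fun_prop
  have hderiv : ∀ a ∈ Ioo 0 r, HasDerivAt
      (fun a => exp (-r) / r * (a ^ 2 / 2 + (a / 2 + 1 / 4) * exp (-(2 * a))))
      (exp (-r) / r * (a * (1 - exp (-(2 * a))))) a := by
    intro a _
    have := ((((hasDerivAt_id a).pow 2).div_const 2).add
      ((((hasDerivAt_id a).div_const 2).add_const (1 / 4)).mul (hexp a))).const_mul (exp (-r) / r)
    refine this.congr_deriv ?_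
    simp only [id_eq, Nat.cast_ofNat]
    ring
  have hnonneg : ∀ a ∈ Ioo 0 r, 0 ≤ exp (-r) / r * (a * (1 - exp (-(2 * a)))) := by
    intro a ha
    have h1 : exp (-(2 * a)) ≤ 1 := Real.exp_le_one_iff.2 (by linarith [ha.1])
    exact mul_nonneg (by positivity) (mul_nonneg ha.1.le (by linarith))
  have hnear : ∫⁻ a in Ioc 0 r, ENNReal.ofReal
        (a * (exp (-a) * ((exp (-|r - a|) - exp (-(r + a))) / r)))
      = ENNReal.ofReal
        (exp (-r) / r * (r ^ 2 / 2 + (r / 2 + 1 / 4) * exp (-(2 * r)) - 1 / 4)) := by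
    rw [setLIntegral_congr Ioo_ae_eq_Ioc.symm,
      setLIntegral_congr_fun (g := fun a => ENNReal.ofReal
        (exp (-r) / r * (a * (1 - exp (-(2 * a)))))) measurableSet_Ioo ?_,
      lintegral_Ioo_eq_sub_of_hasDerivAt_of_nonneg hr.le hcont hderiv hnonneg]
    · congr 1
      simp
      ring
    · intro a ha
      have h1 : exp (-(2 * a)) = exp (-a) * exp (-a) := by rw [← exp_add]; ring_nf
      have h2 : exp (-(r - a)) = exp (-r) * exp a := by rw [← exp_add]; ring_nf
      have h3 : exp (-(r + a)) = exp (-r) * exp (-a) := by rw [← exp_add]; ring_nf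
      have h4 : exp (-a) * exp a = 1 := by rw [← exp_add]; simp
      simp only [abs_of_pos (sub_pos.2 ha.2), h1, h2, h3]
      congr 1
      linear_combination a * exp (-r) / r * h4
  have hfar : ∫⁻ a in Ioi r, ENNReal.ofReal
        (a * (exp (-a) * ((exp (-|r - a|) - exp (-(r + a))) / r)))
      = ENNReal.ofReal ((exp r - exp (-r)) / r * ((r / 2 + 1 / 4) * exp (-(2 * r)))) := by
    have hc : 0 ≤ (exp r - exp (-r)) / r :=
      div_nonneg (sub_nonneg.2 (exp_le_exp.2 (by linarith))) hr.le
    rw [setLIntegral_congr_fun (g := fun a => ENNReal.ofReal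
        ((exp r - exp (-r)) / r * (a * exp (-(2 * a))))) measurableSet_Ioi ?_,
      lintegral_Ioi_eq_sub_of_hasDerivAt_of_nonneg (l := 0) (F := fun a =>
        -((exp r - exp (-r)) / r * ((a / 2 + 1 / 4) * exp (-(2 * a)))))]
    · simp
    · intro a _
      have := (((((hasDerivAt_id a).div_const 2).add_const (1 / 4)).mul
        (hexp a)).const_mul ((exp r - exp (-r)) / r)).neg
      refine this.congr_deriv ?_
      simp only [id_eq]
      ring
    · intro a ha
      have : 0 < a := hr.trans ha
      positivity
    · have h2 : Tendsto (fun a : ℝ => 2 * a) atTop atTop := tendsto_id.const_mul_atTop two_pos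
      have h0 := (tendsto_pow_mul_exp_neg_atTop_nhds_zero 0).comp h2
      have h1 := (tendsto_pow_mul_exp_neg_atTop_nhds_zero 1).comp h2
      have := (((h1.div_const 4).add (h0.div_const 4)).const_mul ((exp r - exp (-r)) / r)).neg
      refine (this.congr fun a => ?_).trans (by simp)
      simp only [Function.comp_apply]
      ring
    · intro a (ha : r < a)
      have h1 : exp (-(2 * a)) = exp (-a) * exp (-a) := by rw [← exp_add]; ring_nf
      have h2 : exp (-(a - r)) = exp r * exp (-a) := by rw [← exp_add]; ring_nf
      have h3 : exp (-(r + a)) = exp (-r) * exp (-a) := by rw [← exp_add]; ring_nf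
      simp only [abs_sub_comm r a, abs_of_pos (sub_pos.2 ha), h1, h2, h3]
      congr 1
      ring
  rw [hsplit, lintegral_union measurableSet_Ioi (Ioc_disjoint_Ioi le_rfl), hnear, hfar,
    ← ENNReal.ofReal_add]
  · congr 1
    have h1 : exp (-(2 * r)) = exp (-r) * exp (-r) := by rw [← exp_add]; ring_nf
    have h4 : exp (-r) * exp r = 1 := by rw [← exp_add]; simp
    rw [h1]
    field_simp
    linear_combination 2 * (2 * r + 1) * h4
  · have h := monotoneOn_of_hasDerivWithinAt_nonneg (convex_Icc 0 r) hcont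
      (fun a ha => (hderiv a (by simpa using ha)).hasDerivWithinAt)
      (fun a ha => hnonneg a (by simpa using ha))
      (left_mem_Icc.2 hr.le) (right_mem_Icc.2 hr.le) hr.le
    simp only [mul_zero, neg_zero, exp_zero] at h
    linarith
  · exact mul_nonneg (div_nonneg (sub_nonneg.2 (exp_le_exp.2 (by linarith))) hr.le)
      (by positivity)

/-- The convolution of `e^{-|η|}` and `e^{-|η|} / |η|` in three dimensions. -/
theorem lintegral_exp_neg_norm_mul_exp_neg_norm_sub_div {ξ : EuclideanSpace ℝ (Fin 3)}
    (hξ : ξ ≠ 0) :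
    ∫⁻ η : EuclideanSpace ℝ (Fin 3),
        ENNReal.ofReal (exp (-‖η‖) * (exp (-‖ξ - η‖) / ‖ξ - η‖))
      = ENNReal.ofReal (π * (exp (-‖ξ‖) * (‖ξ‖ + 1))) := by
  have hr : 0 < ‖ξ‖ := norm_pos_iff.2 hξ
  set r := ‖ξ‖ with hr_def
  obtain ⟨b, hb⟩ : ∃ b : OrthonormalBasis (Fin 3) ℝ (EuclideanSpace ℝ (Fin 3)),
      ∀ i ∈ ({0} : Set (Fin 3)), b i = r⁻¹ • ξ := by
    refine Orthonormal.exists_orthonormalBasis_extension_of_card_eq (by simp)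
      (v := fun _ => r⁻¹ • ξ) ⟨fun i => ?_, fun i j hij => ?_⟩
    · simp [norm_smul, ← hr_def, hr.ne', abs_of_pos hr]
    · exact absurd (Subsingleton.elim i j) hij
  have hnorm : ∀ η : EuclideanSpace ℝ (Fin 3),
      ‖ξ - η‖ = √(r ^ 2 - 2 * r * b.repr η 0 + ‖b.repr η‖ ^ 2) := by
    intro η
    have hin : r * b.repr η 0 = inner ℝ ξ η := by
      rw [b.repr_apply_apply, hb 0 rfl, real_inner_smul_left, mul_inv_cancel_left₀ hr.ne']
    rw [mul_assoc, hin, b.repr.norm_map, ← norm_sub_sq_real, Real.sqrt_sq (norm_nonneg _)]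
  let f : ℝ → ℝ → ℝ≥0∞ := fun a z => ENNReal.ofReal (exp (-a) *
    (exp (-√(r ^ 2 - 2 * r * z + a ^ 2)) / √(r ^ 2 - 2 * r * z + a ^ 2)))
  have hf : Measurable (Function.uncurry f) := by
    unfold f Function.uncurry
    fun_prop
  have hrot := b.measurePreserving_repr.lintegral_comp
    (f := fun x : EuclideanSpace ℝ (Fin 3) => f ‖x‖ (x 0))
    (hf.comp (f := fun x : EuclideanSpace ℝ (Fin 3) => (‖x‖, x 0)) (by fun_prop))
  calc _ = ∫⁻ η, f ‖b.repr η‖ (b.repr η 0) := by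
        refine lintegral_congr fun η => ?_
        simp only [f, hnorm, b.repr.norm_map]
    _ = ENNReal.ofReal (2 * π) *
        ∫⁻ a in Ioi (0 : ℝ), ENNReal.ofReal a * ∫⁻ z in Ioo (-a) a, f a z := by
        rw [hrot, lintegral_norm_coord hf]
    _ = ENNReal.ofReal (2 * π) * ENNReal.ofReal (exp (-r) * (r + 1) / 2) := by
        rw [← lintegral_radial_exp hr]
        congr 1
        refine setLIntegral_congr_fun measurableSet_Ioi fun a ha => ?_
        simp only [f, ENNReal.ofReal_mul (exp_nonneg (-a))]
        rw [lintegral_const_mul' _ _ ENNReal.ofReal_ne_top,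
          lintegral_exp_neg_dist_div_dist hr ha, ENNReal.ofReal_mul (le_of_lt ha),
          ENNReal.ofReal_mul (exp_nonneg (-a))]
    _ = _ := by
        rw [← ENNReal.ofReal_mul (by positivity)]
        congr 1
        ring

/-- Mean reversion of the Bessel branching density: a random vector `W` with density
`H_b(·|ξ)` satisfies `𝔼|W| = (|ξ| + 1)/2`, i.e. `∫ |η| H_b(η|ξ) dη = (|ξ| + 1)/2`. -/
theorem bessel_mean_reversion
    (ξ : EuclideanSpace ℝ (Fin 3)) (hξ : ξ ≠ 0) :
    ∫⁻ η : EuclideanSpace ℝ (Fin 3),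
        ENNReal.ofReal (‖η‖ * besselBranchingDensity ξ η)
      = ENNReal.ofReal ((‖ξ‖ + 1) / 2) := by
  have hC : 0 ≤ exp ‖ξ‖ / (2 * π) := by positivity
  have hae : ∀ᵐ η : EuclideanSpace ℝ (Fin 3), η ≠ 0 := by simp [ae_iff]
  have hcongr : ∀ᵐ η : EuclideanSpace ℝ (Fin 3),
      ENNReal.ofReal (‖η‖ * besselBranchingDensity ξ η) = ENNReal.ofReal (exp ‖ξ‖ / (2 * π)) *
        ENNReal.ofReal (exp (-‖η‖) * (exp (-‖ξ - η‖) / ‖ξ - η‖)) := by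
    filter_upwards [hae] with η hη
    rw [← ENNReal.ofReal_mul hC, besselBranchingDensity]
    congr 1
    rw [mul_left_comm, ← mul_div_assoc, mul_div_mul_left _ _ (norm_ne_zero_iff.2 hη), mul_div_assoc]
  rw [lintegral_congr_ae hcongr, lintegral_const_mul' _ _ ENNReal.ofReal_ne_top,
    lintegral_exp_neg_norm_mul_exp_neg_norm_sub_div hξ, ← ENNReal.ofReal_mul hC]
  congr 1
  have h : exp ‖ξ‖ * exp (-‖ξ‖) = 1 := by rw [← exp_add]; simp
  field_simp
  linear_combination h
end

section
/- Let u > 0 and define the probability density p_u on [0,∞) by p_u(w) = (1/u)·e^{−2w}·(e^{2u} − 1) for w ≥ u and p_u(w) = (1/u)·(1 − e^{−2w}) for 0 ≤ w ≤ u. Then for every λ > 0 and every u > 0, ∫₀^∞ (λ/(λ + w²))·p_u(w) dw ≤ π·√λ. -/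
open MeasureTheory Real

/-- The density of the norm of one step of the Bessel branching Markov chain started
at norm `u`: `p_u(w) = (1/u) e^{−2w}(e^{2u} − 1)` for `w ≥ u` and
`p_u(w) = (1/u)(1 − e^{−2w})` for `0 ≤ w ≤ u`. -/
noncomputable def besselStepDensity (u w : ℝ) : ℝ :=
  if u ≤ w then (1 / u) * Real.exp (-(2 * w)) * (Real.exp (2 * u) - 1)
  else (1 / u) * (1 - Real.exp (-(2 * w)))

/-- The step density is bounded by `2`. -/
lemma besselStepDensity_le_two {u : ℝ} (hu : 0 < u) (w : ℝ) :
    besselStepDensity u w ≤ 2 := by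
  have key : ∀ x : ℝ, 1 - Real.exp (-(2 * x)) ≤ 2 * x := fun x => by
    linarith [Real.add_one_le_exp (-(2 * x))]
  unfold besselStepDensity
  split_ifs with h
  · have h₁ : Real.exp (-(2 * w)) * (Real.exp (2 * u) - 1) ≤ 2 * u :=
      calc Real.exp (-(2 * w)) * (Real.exp (2 * u) - 1)
          ≤ Real.exp (-(2 * u)) * (Real.exp (2 * u) - 1) := by
            have h₂ : 0 ≤ Real.exp (2 * u) - 1 := by
              linarith [Real.add_one_le_exp (2 * u)]
            gcongr
        _ = 1 - Real.exp (-(2 * u)) := by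
            rw [mul_sub, ← Real.exp_add]
            simp
        _ ≤ 2 * u := key u
    rw [mul_assoc, one_div_mul_eq_div, div_le_iff₀ hu]
    exact h₁
  · rw [one_div_mul_eq_div, div_le_iff₀ hu]
    linarith [key w, not_le.mp h]

lemma div_add_sq_eq_inv_one_add_sq {a : ℝ} (ha : 0 < a) (w : ℝ) :
    a / (a + w ^ 2) = (1 + ((√a)⁻¹ * w) ^ 2)⁻¹ := by
  have h : 0 < a + w ^ 2 := by positivity
  rw [mul_pow, inv_pow, Real.sq_sqrt ha.le]
  field_simp

lemma integrable_div_add_sq {a : ℝ} (ha : 0 < a) :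
    Integrable fun w : ℝ => a / (a + w ^ 2) := by
  simp_rw [div_add_sq_eq_inv_one_add_sq ha]
  exact integrable_inv_one_add_sq.comp_mul_left' (inv_ne_zero (Real.sqrt_pos.mpr ha).ne')

lemma integral_Ioi_div_add_sq {a : ℝ} (ha : 0 < a) :
    ∫ w in Set.Ioi (0 : ℝ), a / (a + w ^ 2) = √a * (π / 2) := by
  simp_rw [div_add_sq_eq_inv_one_add_sq ha]
  rw [integral_comp_mul_left_Ioi (fun x : ℝ => (1 + x ^ 2)⁻¹) 0
    (inv_pos.mpr (Real.sqrt_pos.mpr ha))]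
  simp

/-- For every `λ > 0` and `u > 0`, `∫₀^∞ (λ/(λ + w²)) p_u(w) dw ≤ π √λ`. -/
theorem bessel_resolvent_bound (u lam : ℝ) (hu : 0 < u) (hlam : 0 < lam) :
    ∫⁻ w in Set.Ici (0 : ℝ),
        ENNReal.ofReal ((lam / (lam + w ^ 2)) * besselStepDensity u w)
      ≤ ENNReal.ofReal (π * Real.sqrt lam) := by
  calc ∫⁻ w in Set.Ici (0 : ℝ),
        ENNReal.ofReal ((lam / (lam + w ^ 2)) * besselStepDensity u w)
      ≤ ∫⁻ w in Set.Ici (0 : ℝ), ENNReal.ofReal ((lam / (lam + w ^ 2)) * 2) := by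
        refine setLIntegral_mono' measurableSet_Ici fun w _ => ENNReal.ofReal_le_ofReal ?_
        exact mul_le_mul_of_nonneg_left (besselStepDensity_le_two hu w) (by positivity)
    _ = ENNReal.ofReal (∫ w in Set.Ici (0 : ℝ), (lam / (lam + w ^ 2)) * 2) :=
        (ofReal_integral_eq_lintegral_ofReal
          ((integrable_div_add_sq hlam).mul_const 2).integrableOn
          (Filter.Eventually.of_forall fun w => by positivity)).symm
    _ = ENNReal.ofReal (π * Real.sqrt lam) := by
        rw [integral_Ici_eq_integral_Ioi, integral_mul_const, integral_Ioi_div_add_sq hlam]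
        ring_nf
end

section
/- Let H̃(θ,r) = (2/π²)·sin(θ)/(1 − 2r·cos(θ) + r²) for θ ∈ (0,π), r > 0. Suppose m̃ : [0,∞) → [0,1] is measurable, antitone (nonincreasing), and satisfies for every λ ≥ 0 the integral equation m̃(λ) = e^{−λ} + ∫₀^λ e^{−(λ−s)} ∫₀^π ∫₀^∞ m̃(r²s)·m̃((1 − 2r·cos(θ) + r²)·s)·H̃(θ,r) dr dθ ds. Then the limit L = lim_{λ→∞} m̃(λ) exists and satisfies L = L², hence L ∈ {0, 1}. -/
open MeasureTheory Real intervalIntegral Filter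

/-- The joint density `H̃(θ,r) = (2/π²) sin θ/(1 − 2r cos θ + r²)` of the polar angle
and radius of the dilogarithmic branching distribution relative to a unit direction. -/
noncomputable def Htilde (θ r : ℝ) : ℝ :=
  (2 / π ^ 2) * Real.sin θ / (1 - 2 * r * Real.cos θ + r ^ 2)

lemma quadratic_cos_pos {θ : ℝ} (hθ : 0 < Real.sin θ) (r : ℝ) :
    0 < 1 - 2 * r * Real.cos θ + r ^ 2 := by
  nlinarith [Real.sin_sq_add_cos_sq θ, sq_nonneg (r - Real.cos θ), pow_pos hθ 2]

lemma quadratic_cos_nonneg (θ r : ℝ) : 0 ≤ 1 - 2 * r * Real.cos θ + r ^ 2 := by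
  nlinarith [Real.sin_sq_add_cos_sq θ, sq_nonneg (r - Real.cos θ), sq_nonneg (Real.sin θ)]

lemma Htilde_nonneg {θ : ℝ} (hθ : 0 < Real.sin θ) (r : ℝ) : 0 ≤ Htilde θ r := by
  have := quadratic_cos_pos hθ r
  unfold Htilde
  positivity

lemma Measurable.Htilde {α : Type*} [MeasurableSpace α] {f g : α → ℝ} (hf : Measurable f)
    (hg : Measurable g) : Measurable (fun x => _root_.Htilde (f x) (g x)) := by
  unfold _root_.Htilde
  fun_prop

lemma hasDerivAt_Htilde_primitive {θ : ℝ} (hθ : 0 < Real.sin θ) (r : ℝ) :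
    HasDerivAt (fun x => (2 / π ^ 2) * arctan ((x - Real.cos θ) / Real.sin θ))
      (Htilde θ r) r := by
  have h := ((((hasDerivAt_id r).sub_const (Real.cos θ)).div_const (Real.sin θ)).arctan).const_mul
    (2 / π ^ 2)
  refine h.congr_deriv ?_
  have hq := (quadratic_cos_pos hθ r).ne'
  have hs := hθ.ne'
  have hq' : 1 + ((r - Real.cos θ) / Real.sin θ) ^ 2
      = (1 - 2 * r * Real.cos θ + r ^ 2) / Real.sin θ ^ 2 := by
    field_simp
    linear_combination Real.sin_sq_add_cos_sq θ
  rw [id, hq', Htilde]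
  field_simp

lemma tendsto_Htilde_primitive {θ : ℝ} (hθ : 0 < Real.sin θ) :
    Tendsto (fun x => (2 / π ^ 2) * arctan ((x - Real.cos θ) / Real.sin θ)) atTop
      (nhds ((2 / π ^ 2) * (π / 2))) := by
  refine Tendsto.const_mul _ ((tendsto_arctan_atTop.mono_right nhdsWithin_le_nhds).comp ?_)
  exact (tendsto_atTop_add_const_right _ (-Real.cos θ) tendsto_id).atTop_div_const hθ

lemma integrableOn_Htilde {θ : ℝ} (hθ : 0 < Real.sin θ) :
    IntegrableOn (Htilde θ) (Set.Ioi 0) :=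
  integrableOn_Ioi_deriv_of_nonneg' (fun x _ => hasDerivAt_Htilde_primitive hθ x)
    (fun x _ => Htilde_nonneg hθ x) (tendsto_Htilde_primitive hθ)

lemma integral_Htilde {θ : ℝ} (h : θ ∈ Set.Ioo 0 π) :
    ∫ r in Set.Ioi (0 : ℝ), Htilde θ r = (2 / π ^ 2) * (π - θ) := by
  have hθ := Real.sin_pos_of_mem_Ioo h
  rw [integral_Ioi_of_hasDerivAt_of_nonneg' (fun x _ => hasDerivAt_Htilde_primitive hθ x)
    (fun x _ => Htilde_nonneg hθ x) (tendsto_Htilde_primitive hθ)]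
  have htan : (0 - Real.cos θ) / Real.sin θ = Real.tan (θ - π / 2) := by
    rw [Real.tan_eq_sin_div_cos, Real.sin_sub_pi_div_two, Real.cos_sub_pi_div_two, zero_sub]
  rw [htan, Real.arctan_tan (by linarith [h.1]) (by linarith [h.2])]
  ring

lemma integral_pi_sub : ∫ θ in (0 : ℝ)..π, (2 / π ^ 2) * (π - θ) = 1 := by
  rw [intervalIntegral.integral_const_mul, intervalIntegral.integral_sub (by simp) (by simp)]
  simp only [intervalIntegral.integral_const, integral_id, smul_eq_mul]
  field_simp
  ring

section Branching

variable {m : ℝ → ℝ}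

lemma norm_mul_mul_Htilde_le (hrange : ∀ lam : ℝ, 0 ≤ lam → m lam ∈ Set.Icc (0 : ℝ) 1)
    {s θ : ℝ} (hs : 0 ≤ s) (hθ : 0 < Real.sin θ) (r : ℝ) :
    ‖m (r ^ 2 * s) * m ((1 - 2 * r * Real.cos θ + r ^ 2) * s) * Htilde θ r‖ ≤ Htilde θ r := by
  obtain ⟨a0, a1⟩ := hrange (r ^ 2 * s) (by positivity)
  obtain ⟨b0, b1⟩ := hrange _ (mul_nonneg (quadratic_cos_nonneg θ r) hs)
  have hH := Htilde_nonneg hθ r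
  rw [Real.norm_of_nonneg (by positivity)]
  exact mul_le_of_le_one_left hH (mul_le_one₀ a1 b0 b1)

lemma norm_integral_radius_le (hrange : ∀ lam : ℝ, 0 ≤ lam → m lam ∈ Set.Icc (0 : ℝ) 1)
    {s θ : ℝ} (hs : 0 ≤ s) (h : θ ∈ Set.Ioo 0 π) :
    ‖∫ r in Set.Ioi (0 : ℝ),
      m (r ^ 2 * s) * m ((1 - 2 * r * Real.cos θ + r ^ 2) * s) * Htilde θ r‖
      ≤ (2 / π ^ 2) * (π - θ) := by
  have hθ := Real.sin_pos_of_mem_Ioo h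
  rw [← integral_Htilde h]
  exact norm_integral_le_of_norm_le (integrableOn_Htilde hθ)
    (Eventually.of_forall (norm_mul_mul_Htilde_le hrange hs hθ))

lemma stronglyMeasurable_integral_radius (hmeas : Measurable m) :
    StronglyMeasurable (fun p : ℝ × ℝ => ∫ r in Set.Ioi (0 : ℝ),
      m (r ^ 2 * p.1) * m ((1 - 2 * r * Real.cos p.2 + r ^ 2) * p.1) * Htilde p.2 r) := by
  have hH : Measurable (fun q : (ℝ × ℝ) × ℝ => Htilde q.1.2 q.2) :=
    (measurable_snd.comp measurable_fst).Htilde measurable_snd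
  have h1 : Measurable (fun q : (ℝ × ℝ) × ℝ => q.2 ^ 2 * q.1.1) := by fun_prop
  have h2 : Measurable (fun q : (ℝ × ℝ) × ℝ =>
      (1 - 2 * q.2 * Real.cos q.1.2 + q.2 ^ 2) * q.1.1) := by fun_prop
  have h : Measurable (fun q : (ℝ × ℝ) × ℝ => m (q.2 ^ 2 * q.1.1) *
      m ((1 - 2 * q.2 * Real.cos q.1.2 + q.2 ^ 2) * q.1.1) * Htilde q.1.2 q.2) :=
    ((hmeas.comp h1).mul (hmeas.comp h2)).mul hH
  exact h.stronglyMeasurable.integral_prod_right (ν := volume.restrict (Set.Ioi (0 : ℝ)))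

lemma measurable_branching (hmeas : Measurable m) :
    Measurable (fun s : ℝ => ∫ θ in (0 : ℝ)..π, ∫ r in Set.Ioi (0 : ℝ),
      m (r ^ 2 * s) * m ((1 - 2 * r * Real.cos θ + r ^ 2) * s) * Htilde θ r) := by
  simp only [intervalIntegral.integral_of_le Real.pi_pos.le]
  exact ((stronglyMeasurable_integral_radius hmeas).integral_prod_right
    (ν := volume.restrict (Set.Ioc (0 : ℝ) π))).measurable

lemma ae_uIoc_mem_Ioo : ∀ᵐ θ : ℝ, θ ∈ Set.uIoc 0 π → θ ∈ Set.Ioo 0 π := by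
  filter_upwards [Measure.ae_ne volume π] with θ hne h
  rw [Set.uIoc_of_le Real.pi_pos.le] at h
  exact ⟨h.1, lt_of_le_of_ne h.2 hne⟩

lemma norm_branching_le_one (hrange : ∀ lam : ℝ, 0 ≤ lam → m lam ∈ Set.Icc (0 : ℝ) 1)
    {s : ℝ} (hs : 0 ≤ s) :
    ‖∫ θ in (0 : ℝ)..π, ∫ r in Set.Ioi (0 : ℝ),
      m (r ^ 2 * s) * m ((1 - 2 * r * Real.cos θ + r ^ 2) * s) * Htilde θ r‖ ≤ 1 := by
  refine (intervalIntegral.norm_integral_le_of_norm_le Real.pi_pos.le ?_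
    (Continuous.intervalIntegrable (by fun_prop) _ _)).trans_eq integral_pi_sub
  filter_upwards [ae_uIoc_mem_Ioo] with θ hθ h
  exact norm_integral_radius_le hrange hs (hθ (by rwa [Set.uIoc_of_le Real.pi_pos.le]))

lemma tendsto_branching (hmeas : Measurable m)
    (hrange : ∀ lam : ℝ, 0 ≤ lam → m lam ∈ Set.Icc (0 : ℝ) 1)
    {L : ℝ} (hL : Tendsto m atTop (nhds L)) :
    Tendsto (fun s : ℝ => ∫ θ in (0 : ℝ)..π, ∫ r in Set.Ioi (0 : ℝ),
      m (r ^ 2 * s) * m ((1 - 2 * r * Real.cos θ + r ^ 2) * s) * Htilde θ r)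
      atTop (nhds (L ^ 2)) := by
  have hlim : L ^ 2 = ∫ θ in (0 : ℝ)..π, L ^ 2 * ((2 / π ^ 2) * (π - θ)) := by
    rw [intervalIntegral.integral_const_mul, integral_pi_sub, mul_one]
  rw [hlim]
  refine intervalIntegral.tendsto_integral_filter_of_dominated_convergence
    (fun θ => (2 / π ^ 2) * (π - θ)) ?_ ?_ (Continuous.intervalIntegrable (by fun_prop) _ _) ?_
  · exact Eventually.of_forall fun s => ((stronglyMeasurable_integral_radius hmeas).comp_measurable
      (measurable_prodMk_left (x := s))).aestronglyMeasurable
  · filter_upwards [eventually_ge_atTop 0] with s hs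
    filter_upwards [ae_uIoc_mem_Ioo] with θ hθ h
    exact norm_integral_radius_le hrange hs (hθ h)
  · filter_upwards [ae_uIoc_mem_Ioo] with θ hθ h
    have hsin := Real.sin_pos_of_mem_Ioo (hθ h)
    rw [← integral_Htilde (hθ h), ← MeasureTheory.integral_const_mul]
    refine tendsto_integral_filter_of_dominated_convergence (Htilde θ) ?_ ?_
      (integrableOn_Htilde hsin) ?_
    · refine Eventually.of_forall fun s => Measurable.aestronglyMeasurable ?_
      have hH : Measurable (Htilde θ) := measurable_const.Htilde measurable_id
      have h1 : Measurable fun r : ℝ => r ^ 2 * s := by fun_prop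
      have h2 : Measurable fun r : ℝ => (1 - 2 * r * Real.cos θ + r ^ 2) * s := by fun_prop
      exact ((hmeas.comp h1).mul (hmeas.comp h2)).mul hH
    · filter_upwards [eventually_ge_atTop 0] with s hs
      exact Eventually.of_forall (norm_mul_mul_Htilde_le hrange hs hsin)
    · filter_upwards [ae_restrict_mem measurableSet_Ioi] with r hr
      have hr2 : (0 : ℝ) < r ^ 2 := pow_pos hr 2
      have h1 := hL.comp (tendsto_id.const_mul_atTop hr2)
      have h2 := hL.comp (tendsto_id.const_mul_atTop (quadratic_cos_pos hsin r))
      rw [sq L]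
      exact (h1.mul h2).mul_const _

end Branching

lemma tendsto_integral_exp_convolution {F : ℝ → ℝ} (hF : Measurable F)
    {C : ℝ} (hbound : ∀ s, 0 ≤ s → ‖F s‖ ≤ C) {ℓ : ℝ} (hlim : Tendsto F atTop (nhds ℓ)) :
    Tendsto (fun x : ℝ => ∫ s in (0 : ℝ)..x, Real.exp (-(x - s)) * F s) atTop (nhds ℓ) := by
  have hℓ : ℓ = ∫ u in Set.Ioi (0 : ℝ), Real.exp (-u) * ℓ := by
    rw [MeasureTheory.integral_mul_const, integral_exp_neg_Ioi_zero, one_mul]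
  have key : Tendsto (fun x : ℝ => ∫ u in Set.Ioi (0 : ℝ),
      (Set.Iic x).indicator (fun u => Real.exp (-u) * F (x - u)) u) atTop (nhds ℓ) := by
    rw [hℓ]
    refine tendsto_integral_filter_of_dominated_convergence (fun u => Real.exp (-u) * C) ?_ ?_
      ((integrableOn_exp_neg_Ioi 0).mul_const C) ?_
    · exact Eventually.of_forall fun x =>
        (Measurable.indicator (by fun_prop) measurableSet_Iic).aestronglyMeasurable
    · refine Eventually.of_forall fun x => Eventually.of_forall fun u => ?_
      have hC : 0 ≤ C := (norm_nonneg _).trans (hbound 0 le_rfl)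
      by_cases hu : u ∈ Set.Iic x
      · rw [Set.indicator_of_mem hu, norm_mul, Real.norm_of_nonneg (Real.exp_pos _).le]
        gcongr
        exact hbound _ (sub_nonneg.2 hu)
      · rw [Set.indicator_of_notMem hu, norm_zero]
        positivity
    · refine Eventually.of_forall fun u => ?_
      have h : Tendsto (fun x => Real.exp (-u) * F (x - u)) atTop (nhds (Real.exp (-u) * ℓ)) :=
        (hlim.comp (tendsto_atTop_add_const_right _ (-u) tendsto_id)).const_mul _
      refine h.congr' ?_
      filter_upwards [eventually_ge_atTop u] with x hx
      rw [Set.indicator_of_mem (Set.mem_Iic.2 hx)]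
  refine key.congr' ?_
  filter_upwards [eventually_ge_atTop 0] with x hx
  rw [setIntegral_indicator measurableSet_Iic, Set.Ioi_inter_Iic,
    ← intervalIntegral.integral_of_le hx]
  have := intervalIntegral.integral_comp_sub_left (a := 0) (b := x)
    (fun s => Real.exp (-(x - s)) * F s) x
  simpa using this

lemma AntitoneOn.exists_tendsto_atTop_of_nonneg {m : ℝ → ℝ} (hanti : AntitoneOn m (Set.Ici 0))
    (hnonneg : ∀ x, 0 ≤ x → 0 ≤ m x) : ∃ L : ℝ, Tendsto m atTop (nhds L) := by
  have h : Antitone fun x => m (max 0 x) := fun a b hab =>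
    hanti (Set.mem_Ici.2 (le_max_left _ _)) (Set.mem_Ici.2 (le_max_left _ _)) (max_le_max_left 0 hab)
  have hb : BddBelow (Set.range fun x => m (max 0 x)) :=
    ⟨0, by rintro _ ⟨x, rfl⟩; exact hnonneg _ (le_max_left _ _)⟩
  refine ⟨_, (tendsto_atTop_ciInf h hb).congr' ?_⟩
  filter_upwards [eventually_ge_atTop 0] with x hx
  rw [max_eq_right hx]

/-- If `m̃ : [0,∞) → [0,1]` is measurable, nonincreasing and satisfies the self-similar
cascade integral equation
`m̃(λ) = e^{−λ} + ∫₀^λ e^{−(λ−s)} ∫₀^π ∫₀^∞ m̃(r²s) m̃((1 − 2r cos θ + r²)s) H̃(θ,r) dr dθ ds`,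
then `L = lim_{λ→∞} m̃(λ)` exists and satisfies `L = L²`, hence `L ∈ {0,1}`. -/
theorem selfSimilar_explosion_zero_one
    (m : ℝ → ℝ) (hmeas : Measurable m)
    (hrange : ∀ lam : ℝ, 0 ≤ lam → m lam ∈ Set.Icc (0 : ℝ) 1)
    (hanti : AntitoneOn m (Set.Ici 0))
    (heq : ∀ lam : ℝ, 0 ≤ lam →
      m lam = Real.exp (-lam) +
        ∫ s in (0 : ℝ)..lam, Real.exp (-(lam - s)) *
          ∫ θ in (0 : ℝ)..π, ∫ r in Set.Ioi (0 : ℝ),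
            m (r ^ 2 * s) * m ((1 - 2 * r * Real.cos θ + r ^ 2) * s) * Htilde θ r) :
    ∃ L : ℝ, Tendsto m atTop (nhds L) ∧ L = L ^ 2 ∧ (L = 0 ∨ L = 1) := by
  obtain ⟨L, hL⟩ := hanti.exists_tendsto_atTop_of_nonneg fun x hx => (hrange x hx).1
  have hconv := (tendsto_exp_neg_atTop_nhds_zero).add (tendsto_integral_exp_convolution
    (measurable_branching hmeas) (fun s hs => norm_branching_le_one hrange hs)
    (tendsto_branching hmeas hrange hL))
  rw [zero_add] at hconv
  have hsq : L = L ^ 2 := by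
    refine tendsto_nhds_unique hL (hconv.congr' ?_)
    filter_upwards [eventually_ge_atTop 0] with x hx
    exact (heq x hx).symm
  refine ⟨L, hL, hsq, ?_⟩
  have h : L * (L - 1) = 0 := by linear_combination -hsq
  exact (mul_eq_zero.1 h).imp_right sub_eq_zero.1
end
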